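/- Let 1 < p < 2, q = p/(p−1), let n ≤ N be positive integers with n ≥ 2, let X be a finite-dimensional Banach space, Y a Banach space with dim(Y) ≤ n, and u : X → Y a linear operator. Then there is an absolute constant C such that ν_q^{(⌈7N/8⌉, 2)}(u) ≤ (1 + C (p−1)^{(p−2)/4} (n/N)^{1/2} (log n)^{(6−p)/4} (log N)^{p/4}) · ν_q^{(N, 1)}(u). -/

import Mathlib

open scoped BigOperators

/-- The sup norm on `Fin k → ℝ` (the norm of `ℓ_∞^k`). -/
noncomputable def supNormFin {k : ℕ} (x : Fin k → ℝ) : ℝ :=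
  sSup (Set.range fun i => |x i|)

/-- The `ℓ_q^k` norm on `Fin k → ℝ`. -/
noncomputable def lqNormFin (q : ℝ) {k : ℕ} (x : Fin k → ℝ) : ℝ :=
  (∑ i, |x i| ^ q) ^ (1 / q)

/-- `ν_q^{(k)}(v)`: the infimum of `‖A‖·‖w‖·‖B‖` over all factorizations `v = B w A`
where `A : X → ℓ_∞^k`, `w : ℓ_∞^k → ℓ_q^k` is a diagonal operator with entries `d`,
and `B : ℓ_q^k → Y`; the three operator norms are computed with respect to the
indicated norms. -/
noncomputable def nuQ (q : ℝ) (k : ℕ) {X Y : Type*} [NormedAddCommGroup X]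
    [NormedSpace ℝ X] [NormedAddCommGroup Y] [NormedSpace ℝ Y] (v : X →ₗ[ℝ] Y) : ℝ :=
  sInf { r : ℝ | ∃ (A : X →ₗ[ℝ] (Fin k → ℝ)) (d : Fin k → ℝ) (B : (Fin k → ℝ) →ₗ[ℝ] Y),
    v = B ∘ₗ (LinearMap.pi fun i => d i • LinearMap.proj i) ∘ₗ A ∧
    r = sSup {a | ∃ x : X, ‖x‖ ≤ 1 ∧ a = supNormFin (A x)} *
        sSup {a | ∃ x : Fin k → ℝ, supNormFin x ≤ 1 ∧ a = lqNormFin q fun i => d i * x i} *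
        sSup {a | ∃ x : Fin k → ℝ, lqNormFin q x ≤ 1 ∧ a = ‖B x‖} }

/-- `ν_q^{(k,m)}(v) = inf { ∑_{i=1}^m ν_q^{(k)}(v_i) : v = ∑_{i=1}^m v_i }`. -/
noncomputable def nuQSplit (q : ℝ) (k m : ℕ) {X Y : Type*} [NormedAddCommGroup X]
    [NormedSpace ℝ X] [NormedAddCommGroup Y] [NormedSpace ℝ Y] (v : X →ₗ[ℝ] Y) : ℝ :=
  sInf { r : ℝ | ∃ u : Fin m → (X →ₗ[ℝ] Y), v = ∑ i, u i ∧ r = ∑ i, nuQ q k (u i) }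

/-- Moment generating function of a Rademacher sum. -/
theorem sum_signs_exp {N : ℕ} (a : Fin N → ℝ) :
    ∑ s : Fin N → Bool, Real.exp (∑ i, (if s i then (1 : ℝ) else -1) * a i)
      = ∏ i, (Real.exp (a i) + Real.exp (-a i)) := by
  have h : ∀ i, Real.exp (a i) + Real.exp (-a i)
      = ∑ b : Bool, Real.exp ((if b then (1 : ℝ) else -1) * a i) := by
    intro i; simp
  simp_rw [h, Finset.prod_univ_sum, Real.exp_sum]
  rw [Fintype.piFinset_univ]

theorem sum_signs_exp_le {N : ℕ} (a : Fin N → ℝ) :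
    ∑ s : Fin N → Bool, Real.exp (∑ i, (if s i then (1 : ℝ) else -1) * a i)
      ≤ 2 ^ N * Real.exp ((∑ i, a i ^ 2) / 2) := by
  rw [sum_signs_exp, Finset.sum_div, Real.exp_sum]
  have : (2 : ℝ) ^ N = ∏ _i : Fin N, (2 : ℝ) := by simp
  rw [this, ← Finset.prod_mul_distrib]
  refine Finset.prod_le_prod (fun i _ => by positivity) fun i _ => ?_
  have := Real.cosh_le_exp_half_sq (a i)
  rw [Real.cosh_eq] at this
  linarith

/-- Hoeffding's tail bound for Rademacher sums, in counting form. -/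
theorem card_signs_tail_le {N : ℕ} (a : Fin N → ℝ) {t : ℝ} (ht : 0 ≤ t) :
    ((Finset.univ.filter fun s : Fin N → Bool =>
      t * √(∑ i, a i ^ 2) < |∑ i, (if s i then (1 : ℝ) else -1) * a i|).card : ℝ)
      ≤ 2 ^ N * (2 * Real.exp (-t ^ 2 / 2)) := by
  set σ := √(∑ i, a i ^ 2) with hσ
  have hσ2 : σ ^ 2 = ∑ i, a i ^ 2 := Real.sq_sqrt (Finset.sum_nonneg fun i _ => sq_nonneg _)
  rcases (Real.sqrt_nonneg (∑ i, a i ^ 2)).eq_or_lt with h0 | hpos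
  · have hz : ∀ i, a i = 0 := by
      have h1 : ∑ i, a i ^ 2 = 0 := by rw [← hσ2, hσ, ← h0]; simp
      intro i
      have := (Finset.sum_eq_zero_iff_of_nonneg (fun i _ => sq_nonneg (a i))).1 h1 i
        (Finset.mem_univ i)
      simpa using this
    have hs : σ = 0 := by rw [hσ, ← h0]
    simp [hz, hs]
    positivity
  · rw [← hσ] at hpos
    set c := t / σ
    have hc : 0 ≤ c := by positivity
    have hcσ : c * σ = t := by simp only [c]; field_simp
    have key : ∀ s : Fin N → Bool,
        t * σ < |∑ i, (if s i then (1 : ℝ) else -1) * a i| →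
        Real.exp (t ^ 2) ≤ Real.exp (∑ i, (if s i then (1 : ℝ) else -1) * (c * a i))
          + Real.exp (∑ i, (if s i then (1 : ℝ) else -1) * (-c * a i)) := by
      intro s hs
      set S := ∑ i, (if s i then (1 : ℝ) else -1) * a i with hS
      have e1 : ∑ i, (if s i then (1 : ℝ) else -1) * (c * a i) = c * S := by
        rw [hS, Finset.mul_sum]; exact Finset.sum_congr rfl fun i _ => by ring
      have e2 : ∑ i, (if s i then (1 : ℝ) else -1) * (-c * a i) = c * -S := by
        rw [hS, ← Finset.sum_neg_distrib, Finset.mul_sum]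
        exact Finset.sum_congr rfl fun i _ => by ring
      rw [e1, e2]
      have e3 : t ^ 2 = c * (t * σ) := by rw [← hcσ]; ring
      rcases abs_cases S with ⟨h, _⟩ | ⟨h, _⟩
      · have : Real.exp (t ^ 2) ≤ Real.exp (c * S) := by
          rw [Real.exp_le_exp, e3]; exact mul_le_mul_of_nonneg_left (by linarith) hc
        linarith [Real.exp_pos (c * -S)]
      · have : Real.exp (t ^ 2) ≤ Real.exp (c * -S) := by
          rw [Real.exp_le_exp, e3]; exact mul_le_mul_of_nonneg_left (by linarith) hc
        linarith [Real.exp_pos (c * S)]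
    have hsq : (∑ i, (c * a i) ^ 2) = t ^ 2 := by
      simp_rw [mul_pow]; rw [← Finset.mul_sum, ← hσ2, ← hcσ]; ring
    have hsq' : (∑ i, (-c * a i) ^ 2) = t ^ 2 := by
      rw [← hsq]; exact Finset.sum_congr rfl fun i _ => by ring
    have h1 : ((Finset.univ.filter fun s : Fin N → Bool =>
        t * σ < |∑ i, (if s i then (1 : ℝ) else -1) * a i|).card : ℝ) * Real.exp (t ^ 2)
        ≤ 2 ^ N * Real.exp (t ^ 2 / 2) + 2 ^ N * Real.exp (t ^ 2 / 2) := by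
      rw [← nsmul_eq_mul, ← Finset.sum_const]
      calc _ ≤ ∑ s ∈ Finset.univ.filter fun s : Fin N → Bool =>
            t * σ < |∑ i, (if s i then (1 : ℝ) else -1) * a i|,
            (Real.exp (∑ i, (if s i then (1 : ℝ) else -1) * (c * a i))
          + Real.exp (∑ i, (if s i then (1 : ℝ) else -1) * (-c * a i))) :=
            Finset.sum_le_sum fun s hs => key s (Finset.mem_filter.1 hs).2
        _ ≤ ∑ s : Fin N → Bool, (Real.exp (∑ i, (if s i then (1 : ℝ) else -1) * (c * a i))
          + Real.exp (∑ i, (if s i then (1 : ℝ) else -1) * (-c * a i))) :=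
            Finset.sum_le_sum_of_subset_of_nonneg (Finset.filter_subset _ _)
              fun s _ _ => by positivity
        _ ≤ _ := by
            rw [Finset.sum_add_distrib]
            have := sum_signs_exp_le fun i => c * a i
            have h2 := sum_signs_exp_le fun i => -c * a i
            rw [hsq] at this
            rw [hsq'] at h2
            exact add_le_add this h2
    have e4 : Real.exp (t ^ 2 / 2) = Real.exp (-t ^ 2 / 2) * Real.exp (t ^ 2) := by
      rw [← Real.exp_add]; congr 1; ring
    rw [e4] at h1
    have := Real.exp_pos (t ^ 2)
    nlinarith

/-- Union bound: signs satisfying finitely many Hoeffding-type constraints. -/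
theorem exists_signs_forall_abs_sum_le {N : ℕ} {ι : Type*} [Fintype ι] (a : ι → Fin N → ℝ)
    (t : ι → ℝ) (ht : ∀ j, 0 ≤ t j) (hsum : ∑ j, 2 * Real.exp (-t j ^ 2 / 2) < 1) :
    ∃ ε : Fin N → ℝ, (∀ i, ε i = 1 ∨ ε i = -1) ∧
      ∀ j, |∑ i, ε i * a j i| ≤ t j * √(∑ i, a j i ^ 2) := by
  classical
  by_contra! hcon
  have hcov : (Finset.univ : Finset (Fin N → Bool)) ⊆ Finset.univ.biUnion fun j =>
      Finset.univ.filter fun s : Fin N → Bool =>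
        t j * √(∑ i, a j i ^ 2) < |∑ i, (if s i then (1 : ℝ) else -1) * a j i| := by
    intro s _
    obtain ⟨j, hj⟩ := hcon (fun i => if s i then 1 else -1) fun i => by
      by_cases h : s i <;> simp [h]
    simp only [Finset.mem_biUnion, Finset.mem_univ, true_and, Finset.mem_filter]
    exact ⟨j, hj⟩
  have h1 := (Finset.card_le_card hcov).trans Finset.card_biUnion_le
  have h2 : (2 : ℝ) ^ N ≤ ∑ j, 2 ^ N * (2 * Real.exp (-t j ^ 2 / 2)) := by
    have h3 : ((Finset.univ : Finset (Fin N → Bool)).card : ℝ) = 2 ^ N := by simp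
    rw [← h3]
    refine (Nat.cast_le.2 h1).trans ?_
    rw [h3]
    push_cast
    exact Finset.sum_le_sum fun j _ => card_signs_tail_le (a j) (ht j)
  rw [← Finset.mul_sum] at h2
  have : (0 : ℝ) < 2 ^ N := by positivity
  nlinarith

/-- A set in which all finite "separated" families have at most `M` elements has a net of at
most `M` elements. -/
theorem exists_net_of_card_le {α : Type*} (S : Set α) (close : α → α → Prop)
    (hrefl : ∀ x, close x x) (hsymm : ∀ x y, close x y → close y x) (M : ℝ)
    (hM : ∀ T : Finset α, (T : Set α) ⊆ S →
      (∀ x ∈ T, ∀ y ∈ T, x ≠ y → ¬ close x y) → (T.card : ℝ) ≤ M) :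
    ∃ T : Finset α, (T : Set α) ⊆ S ∧ (T.card : ℝ) ≤ M ∧ ∀ y ∈ S, ∃ g ∈ T, close y g := by
  classical
  let P : ℕ → Prop := fun k => ∃ T : Finset α, (T : Set α) ⊆ S ∧
      (∀ x ∈ T, ∀ y ∈ T, x ≠ y → ¬ close x y) ∧ T.card = k
  have hP0 : P 0 := ⟨∅, by simp, by simp, rfl⟩
  have hb : ∀ k, P k → k ≤ ⌊M⌋₊ := by
    rintro k ⟨T, h1, h2, rfl⟩
    exact Nat.le_floor (hM T h1 h2)
  obtain ⟨T, h1, h2, h3⟩ : P (Nat.findGreatest P ⌊M⌋₊) := Nat.findGreatest_spec (Nat.zero_le _) hP0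
  refine ⟨T, h1, hM T h1 h2, fun y hy => ?_⟩
  by_contra! hc
  have hyT : y ∉ T := fun h => hc y h (hrefl y)
  have : P (T.card + 1) := by
    refine ⟨insert y T, ?_, ?_, Finset.card_insert_of_notMem hyT⟩
    · rw [Finset.coe_insert]; exact Set.insert_subset hy h1
    · intro x hx z hz hxz
      rw [Finset.mem_insert] at hx hz
      rcases hx with rfl | hx <;> rcases hz with rfl | hz
      · exact absurd rfl hxz
      · exact hc z hz
      · exact fun h => hc x hx (hsymm _ _ h)
      · exact h2 x hx z hz hxz
  have h4 := Nat.le_findGreatest (hb _ this) this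
  omega

open MeasureTheory in
/-- Volumetric bound for separated sets in a ball. -/
theorem card_le_of_norm_separated {E : Type*} [NormedAddCommGroup E] [NormedSpace ℝ E]
    [FiniteDimensional ℝ E] (s : Finset E) {R δ : ℝ} (hR : 0 ≤ R) (hδ : 0 < δ)
    (hs : ∀ c ∈ s, ‖c‖ ≤ R) (h : ∀ c ∈ s, ∀ d ∈ s, c ≠ d → δ ≤ ‖c - d‖) :
    (s.card : ℝ) ≤ (2 * R / δ + 1) ^ Module.finrank ℝ E := by
  borelize E
  let μ : Measure E := Measure.addHaar
  have hδ2 : 0 < δ / 2 := by positivity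
  have hρ : 0 < R + δ / 2 := by positivity
  set A := ⋃ c ∈ s, Metric.ball (c : E) (δ / 2) with hA
  have D : Set.Pairwise (s : Set E) (Function.onFun Disjoint fun c => Metric.ball (c : E) (δ / 2)) := by
    rintro c hc d hd hcd
    apply Metric.ball_disjoint_ball
    rw [dist_eq_norm]
    linarith [h c hc d hd hcd]
  have A_subset : A ⊆ Metric.ball (0 : E) (R + δ / 2) := by
    refine Set.iUnion₂_subset fun x hx => ?_
    apply Metric.ball_subset_ball'
    rw [dist_zero_right]
    linarith [hs x hx]
  have I : (s.card : ENNReal) * ENNReal.ofReal ((δ / 2) ^ Module.finrank ℝ E) * μ (Metric.ball 0 1) ≤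
      ENNReal.ofReal ((R + δ / 2) ^ Module.finrank ℝ E) * μ (Metric.ball 0 1) :=
    calc
      _ = μ A := by
        rw [hA, measure_biUnion_finset D fun c _ => measurableSet_ball]
        simp only [μ.addHaar_ball_of_pos _ hδ2]
        simp only [Finset.sum_const, nsmul_eq_mul, mul_assoc]
      _ ≤ μ (Metric.ball (0 : E) (R + δ / 2)) := measure_mono A_subset
      _ = _ := by simp only [μ.addHaar_ball_of_pos _ hρ]
  have J := (ENNReal.mul_le_mul_iff_left (Metric.measure_ball_pos μ (0 : E) zero_lt_one).ne'
    measure_ball_lt_top.ne).1 I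
  have K := ENNReal.toReal_le_of_le_ofReal (pow_nonneg hρ.le _) J
  rw [ENNReal.toReal_mul, ENNReal.toReal_natCast, ENNReal.toReal_ofReal (by positivity)] at K
  have e : 2 * R / δ + 1 = (R + δ / 2) / (δ / 2) := by field_simp
  rw [e, div_pow, le_div_iff₀ (by positivity)]
  exact K

section Gaussian

open MeasureTheory

variable {V : Type*} [NormedAddCommGroup V] [InnerProductSpace ℝ V]

theorem pow_le_exp_add_exp_neg (l : ℕ) (u : ℝ) :
    u ^ (2 * l) ≤ (2 * l : ℝ) ^ l *
      (Real.exp (√(2 * l) * u) + Real.exp (-(√(2 * l) * u))) := by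
  rcases Nat.eq_zero_or_pos l with rfl | hl
  · simp
  have hl' : (0 : ℝ) < 2 * l := by positivity
  set s := √(2 * l : ℝ) with hs
  have hs2 : s ^ 2 = 2 * l := Real.sq_sqrt hl'.le
  have h1 := Real.pow_div_factorial_le_exp |s * u| (abs_nonneg _) (2 * l)
  have h2 : Real.exp |s * u| ≤ Real.exp (s * u) + Real.exp (-(s * u)) := by
    rcases abs_cases (s * u) with ⟨h, _⟩ | ⟨h, _⟩ <;> rw [h]
    · linarith [Real.exp_pos (-(s * u))]
    · linarith [Real.exp_pos (s * u)]
  have h3 : |s * u| ^ (2 * l) = (2 * l : ℝ) ^ l * u ^ (2 * l) := by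
    rw [pow_mul, sq_abs, ← pow_mul, mul_pow, pow_mul s, hs2]
  have h4 : ((2 * l).factorial : ℝ) ≤ (2 * l : ℝ) ^ l * (2 * l : ℝ) ^ l := by
    rw [← pow_add, ← two_mul]
    exact_mod_cast Nat.factorial_le_pow (2 * l)
  rw [h3, div_le_iff₀ (by positivity)] at h1
  have h5 : (0 : ℝ) < (2 * l : ℝ) ^ l := by positivity
  have h6 : (2 * l : ℝ) ^ l * u ^ (2 * l) ≤ (2 * l : ℝ) ^ l * ((2 * l : ℝ) ^ l *
      (Real.exp (s * u) + Real.exp (-(s * u)))) := by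
    refine h1.trans ?_
    calc _ ≤ (Real.exp (s * u) + Real.exp (-(s * u))) * ((2 * l : ℝ) ^ l * (2 * l : ℝ) ^ l) := by
          gcongr
      _ = _ := by ring
  exact le_of_mul_le_mul_left h6 h5

theorem pow_inner_mul_gaussian_le (l : ℕ) {e : V} (he : ‖e‖ ≤ 1) (x : V) :
    inner ℝ x e ^ (2 * l) * Real.exp (-‖x‖ ^ 2 / 2) ≤
      (6 * l : ℝ) ^ l * (Real.exp (-‖x + √(2 * l) • e‖ ^ 2 / 2)
        + Real.exp (-‖x + (-√(2 * l)) • e‖ ^ 2 / 2)) := by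
  set s := √(2 * l : ℝ) with hs
  have hs2 : s ^ 2 = 2 * l := Real.sq_sqrt (by positivity)
  have hshift : ∀ r : ℝ, r ^ 2 = 2 * l → Real.exp (r * inner ℝ x e) * Real.exp (-‖x‖ ^ 2 / 2)
      ≤ Real.exp l * Real.exp (-‖x + (-r) • e‖ ^ 2 / 2) := by
    intro r hr
    rw [← Real.exp_add, ← Real.exp_add, Real.exp_le_exp, norm_add_sq_real, norm_smul,
      inner_smul_right, mul_pow, Real.norm_eq_abs, sq_abs, neg_sq, hr]
    have : ‖e‖ ^ 2 ≤ 1 := by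
      have := norm_nonneg e; nlinarith
    have hl : (0 : ℝ) ≤ l := Nat.cast_nonneg l
    nlinarith
  have h1 := hshift s hs2
  have h2 := hshift (-s) (by rw [neg_sq, hs2])
  rw [neg_neg, neg_mul] at h2
  have h3 := pow_le_exp_add_exp_neg l (inner ℝ x e)
  rw [← hs] at h3
  have hexp : (2 * l : ℝ) ^ l * Real.exp l ≤ (6 * l : ℝ) ^ l := by
    have : Real.exp (l : ℝ) ≤ 3 ^ l := by
      have h := Real.exp_one_lt_d9
      rw [← Real.exp_one_pow]
      exact pow_le_pow_left₀ (Real.exp_pos _).le (by linarith) l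
    calc _ ≤ (2 * l : ℝ) ^ l * 3 ^ l := by gcongr
      _ = _ := by rw [← mul_pow]; ring
  have hE : 0 ≤ Real.exp (-‖x + s • e‖ ^ 2 / 2) + Real.exp (-‖x + (-s) • e‖ ^ 2 / 2) := by
    positivity
  calc _ ≤ (2 * l : ℝ) ^ l * (Real.exp (s * inner ℝ x e) + Real.exp (-(s * inner ℝ x e)))
          * Real.exp (-‖x‖ ^ 2 / 2) := by gcongr
    _ ≤ (2 * l : ℝ) ^ l * (Real.exp l * Real.exp (-‖x + (-s) • e‖ ^ 2 / 2)
          + Real.exp l * Real.exp (-‖x + s • e‖ ^ 2 / 2)) := by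
        rw [mul_assoc, add_mul]; gcongr
    _ = ((2 * l : ℝ) ^ l * Real.exp l) * (Real.exp (-‖x + s • e‖ ^ 2 / 2)
        + Real.exp (-‖x + (-s) • e‖ ^ 2 / 2)) := by ring
    _ ≤ _ := by gcongr

theorem gaussian_add_gaussian_sub_ge (x y : V) :
    2 * (Real.exp (-‖y‖ ^ 2 / 2) * Real.exp (-‖x‖ ^ 2 / 2)) ≤
      Real.exp (-‖x + y‖ ^ 2 / 2) + Real.exp (-‖x - y‖ ^ 2 / 2) := by
  rw [norm_add_sq_real, norm_sub_sq_real]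
  have e1 : -(‖x‖ ^ 2 + 2 * inner ℝ x y + ‖y‖ ^ 2) / 2 =
    (-‖y‖ ^ 2 / 2 + -‖x‖ ^ 2 / 2) + -inner ℝ x y := by ring
  have e2 : -(‖x‖ ^ 2 - 2 * inner ℝ x y + ‖y‖ ^ 2) / 2 =
    (-‖y‖ ^ 2 / 2 + -‖x‖ ^ 2 / 2) + inner ℝ x y := by ring
  rw [e1, e2, ← Real.exp_add, Real.exp_add _ (-inner ℝ x y), Real.exp_add _ (inner ℝ x y)]
  have h1 := Real.add_one_le_exp (inner ℝ x y)
  have h2 := Real.add_one_le_exp (-inner ℝ x y)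
  have := Real.exp_pos (-‖y‖ ^ 2 / 2 + -‖x‖ ^ 2 / 2)
  nlinarith

variable [FiniteDimensional ℝ V] [MeasurableSpace V] [BorelSpace V]

theorem lintegral_gaussian_ne_top :
    ∫⁻ x : V, ENNReal.ofReal (Real.exp (-‖x‖ ^ 2 / 2)) ≠ ⊤ := by
  have h : Integrable (fun x : V => Real.exp (-(1 / 2) * ‖x‖ ^ 2)) := by
    have := (GaussianFourier.integrable_cexp_neg_mul_sq_norm_add (V := V) (b := 1 / 2)
      (by norm_num) 0 0).norm
    refine this.congr (Filter.Eventually.of_forall fun x => ?_)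
    simp only [Complex.norm_exp]
    congr 1
    simp [← Complex.ofReal_pow]
  have h2 := h.lintegral_lt_top.ne
  convert h2 using 6
  ring

theorem lintegral_gaussian_ne_zero :
    ∫⁻ x : V, ENNReal.ofReal (Real.exp (-‖x‖ ^ 2 / 2)) ≠ 0 := by
  rw [Ne, lintegral_eq_zero_iff (by fun_prop)]
  intro h
  have h3 : ∀ᵐ x : V, False := by
    filter_upwards [h] with x hx
    simp only [Pi.zero_apply, ENNReal.ofReal_eq_zero] at hx
    exact absurd (Real.exp_pos (-‖x‖ ^ 2 / 2)) (not_lt.2 hx)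
  rw [Filter.eventually_false_iff_eq_bot, ae_eq_bot] at h3
  exact NeZero.ne (volume : Measure V) h3

theorem lintegral_pow_inner_gaussian_le (l : ℕ) {e : V} (he : ‖e‖ ≤ 1) :
    ∫⁻ x : V, ENNReal.ofReal (inner ℝ x e ^ (2 * l)) * ENNReal.ofReal (Real.exp (-‖x‖ ^ 2 / 2)) ≤
      ENNReal.ofReal (2 * (6 * l : ℝ) ^ l) *
        ∫⁻ x : V, ENNReal.ofReal (Real.exp (-‖x‖ ^ 2 / 2)) := by
  set g : V → ENNReal := fun x => ENNReal.ofReal (Real.exp (-‖x‖ ^ 2 / 2)) with hg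
  have hgm : Measurable g := by fun_prop
  calc _ ≤ ∫⁻ x : V, ENNReal.ofReal ((6 * l : ℝ) ^ l) *
        (g (x + √(2 * l) • e) + g (x + (-√(2 * l)) • e)) := by
        refine lintegral_mono fun x => ?_
        have hp : 0 ≤ (inner ℝ x e : ℝ) ^ (2 * l) := by rw [pow_mul]; positivity
        simp only [hg]
        rw [← ENNReal.ofReal_mul hp, ← ENNReal.ofReal_add (by positivity) (by positivity),
          ← ENNReal.ofReal_mul (by positivity)]
        exact ENNReal.ofReal_le_ofReal (pow_inner_mul_gaussian_le l he x)
    _ = ENNReal.ofReal ((6 * l : ℝ) ^ l) * ((∫⁻ x, g x) + ∫⁻ x, g x) := by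
        rw [lintegral_const_mul _ (by fun_prop), lintegral_add_left (by fun_prop),
          lintegral_add_right_eq_self g, lintegral_add_right_eq_self g]
    _ = _ := by
        rw [← two_mul, ← mul_assoc, mul_comm 2 ((6 * l : ℝ) ^ l),
          ENNReal.ofReal_mul (by positivity)]
        simp

/-- Gaussian measure of translates of a symmetric set. -/
theorem setLIntegral_gaussian_translate_ge {A : Set V} (hA : MeasurableSet A)
    (hsymm : ∀ x, x ∈ A → -x ∈ A) (y : V) :
    ENNReal.ofReal (Real.exp (-‖y‖ ^ 2 / 2)) *
      ∫⁻ x in A, ENNReal.ofReal (Real.exp (-‖x‖ ^ 2 / 2)) ≤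
      ∫⁻ x in {x | x - y ∈ A}, ENNReal.ofReal (Real.exp (-‖x‖ ^ 2 / 2)) := by
  set g : V → ENNReal := fun x => ENNReal.ofReal (Real.exp (-‖x‖ ^ 2 / 2)) with hg
  have hgm : Measurable g := by fun_prop
  have hAy : MeasurableSet {x | x - y ∈ A} := (measurable_sub_const y) hA
  have e1 : ∫⁻ x in {x | x - y ∈ A}, g x = ∫⁻ x in A, g (x + y) := by
    rw [← lintegral_indicator hAy, ← lintegral_indicator hA,
      ← lintegral_add_right_eq_self _ y]
    refine lintegral_congr fun x => ?_
    by_cases h : x ∈ A <;> simp [Set.indicator, h]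
  have e2 : ∫⁻ x in A, g (x + y) = ∫⁻ x in A, g (x - y) := by
    rw [← lintegral_indicator hA, ← lintegral_indicator hA, ← lintegral_neg_eq_self]
    refine lintegral_congr fun x => ?_
    have hiff : -x ∈ A ↔ x ∈ A := ⟨fun h => by simpa using hsymm _ h, hsymm x⟩
    by_cases h : x ∈ A
    · simp only [Set.indicator, hiff, h, if_true, hg]
      rw [← norm_neg (-x + y)]
      congr 5; abel_nf
    · simp [Set.indicator, hiff, h]
  have e3 : 2 * (ENNReal.ofReal (Real.exp (-‖y‖ ^ 2 / 2)) * ∫⁻ x in A, g x) ≤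
      (∫⁻ x in A, g (x + y)) + ∫⁻ x in A, g (x - y) := by
    rw [← lintegral_add_left (by fun_prop), ← lintegral_const_mul _ hgm,
      ← lintegral_const_mul _ (by fun_prop)]
    refine lintegral_mono fun x => ?_
    simp only [hg]
    rw [← ENNReal.ofReal_mul (by positivity), ← ENNReal.ofReal_add (by positivity) (by positivity)]
    have : (2 : ENNReal) = ENNReal.ofReal 2 := by simp
    rw [this, ← ENNReal.ofReal_mul (by positivity)]
    exact ENNReal.ofReal_le_ofReal (gaussian_add_gaussian_sub_ge x y)
  rw [e1]
  rw [← e2, ← two_mul] at e3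
  exact (ENNReal.mul_le_mul_iff_right (by simp) (by simp)).1 e3

/-- Dual Sudakov type bound: sets separated for a weighted `L_{2l}` norm of the coordinates
inside a Euclidean ball. -/
theorem card_le_of_gaussian_separated {ι : Type*} [Fintype ι] {lam : ι → ℝ}
    (hlam : ∀ i, 0 ≤ lam i) (hsum : ∑ i, lam i ≤ 1) {e : ι → V} (he : ∀ i, ‖e i‖ ≤ 1)
    {l : ℕ} (hl : 1 ≤ l) {c : V} {ρ t : ℝ} (ht : 0 < t) {T : Finset V}
    (hT : ∀ y ∈ T, ‖y - c‖ ≤ ρ)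
    (hsep : ∀ x ∈ T, ∀ y ∈ T, x ≠ y →
      ¬ ∑ i, lam i * inner ℝ (x - y) (e i) ^ (2 * l) ≤ t ^ (2 * l)) :
    (T.card : ℝ) ≤ 2 * Real.exp (48 * l * ρ ^ 2 / t ^ 2) := by
  set g : V → ENNReal := fun x => ENNReal.ofReal (Real.exp (-‖x‖ ^ 2 / 2)) with hg
  have hgm : Measurable g := by fun_prop
  set Z := ∫⁻ x, g x with hZ
  have hZtop : Z ≠ ⊤ := lintegral_gaussian_ne_top
  have hZ0 : Z ≠ 0 := lintegral_gaussian_ne_zero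
  set F : V → ℝ := fun x => ∑ i, lam i * inner ℝ x (e i) ^ (2 * l) with hF
  have hFm : Measurable F := by
    have : Continuous F := by fun_prop
    exact this.measurable
  set K : ℝ := (6 * l : ℝ) ^ l with hK
  have hl' : (1 : ℝ) ≤ l := by exact_mod_cast hl
  have hK0 : 0 < K := by positivity
  set A : Set V := {x | F x ≤ 4 * K} with hA
  have hAm : MeasurableSet A := measurableSet_le hFm measurable_const
  have hFneg : ∀ x, F (-x) = F x := fun x => by
    simp only [hF, inner_neg_left, (even_two_mul l).neg_pow]
  have hAsymm : ∀ x, x ∈ A → -x ∈ A := fun x hx => by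
    simp only [hA, Set.mem_ofPred_eq, hFneg]; exact hx
  have hF0 : ∀ x, 0 ≤ F x := fun x =>
    Finset.sum_nonneg fun i _ => mul_nonneg (hlam i) ((even_two_mul l).pow_nonneg _)
  have hFint : ∫⁻ x, ENNReal.ofReal (F x) * g x ≤ ENNReal.ofReal (2 * K) * Z := by
    have e1 : ∀ x, ENNReal.ofReal (F x) * g x = ∑ i, ENNReal.ofReal (lam i) *
        (ENNReal.ofReal (inner ℝ x (e i) ^ (2 * l)) * g x) := fun x => by
      simp only [hF]
      rw [ENNReal.ofReal_sum_of_nonneg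
        fun i _ => mul_nonneg (hlam i) ((even_two_mul l).pow_nonneg _), Finset.sum_mul]
      refine Finset.sum_congr rfl fun i _ => ?_
      rw [ENNReal.ofReal_mul (hlam i), mul_assoc]
    simp only [e1]
    rw [lintegral_finsetSum _ (fun i _ => by fun_prop)]
    calc _ ≤ ∑ i, ENNReal.ofReal (lam i) * (ENNReal.ofReal (2 * K) * Z) := by
          refine Finset.sum_le_sum fun i _ => ?_
          rw [lintegral_const_mul _ (by fun_prop)]
          gcongr
          exact lintegral_pow_inner_gaussian_le l (he i)
      _ = ENNReal.ofReal (∑ i, lam i) * (ENNReal.ofReal (2 * K) * Z) := by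
          rw [← Finset.sum_mul, ENNReal.ofReal_sum_of_nonneg fun i _ => hlam i]
      _ ≤ 1 * (ENNReal.ofReal (2 * K) * Z) := by
          gcongr
          exact ENNReal.ofReal_le_one.2 hsum
      _ = _ := one_mul _
  have hmarkov : 2 * ∫⁻ x in Aᶜ, g x ≤ Z := by
    have h1 : ENNReal.ofReal (4 * K) * ∫⁻ x in Aᶜ, g x ≤ ENNReal.ofReal (2 * K) * Z := by
      refine le_trans ?_ hFint
      rw [← lintegral_const_mul _ hgm]
      refine le_trans ?_ (setLIntegral_le_lintegral Aᶜ _)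
      refine setLIntegral_mono (by fun_prop) fun x hx => ?_
      have : 4 * K ≤ F x := le_of_not_ge hx
      gcongr
    have e2 : ENNReal.ofReal (4 * K) = ENNReal.ofReal (2 * K) * 2 := by
      have : (2 : ENNReal) = ENNReal.ofReal 2 := by simp
      rw [this, ← ENNReal.ofReal_mul (by positivity)]; ring_nf
    rw [e2, mul_assoc] at h1
    exact (ENNReal.mul_le_mul_iff_right (by simpa using hK0) ENNReal.ofReal_ne_top).1 h1
  have hAZ : Z ≤ 2 * ∫⁻ x in A, g x := by
    have h1 : (∫⁻ x in A, g x) + ∫⁻ x in Aᶜ, g x = Z := lintegral_add_compl g hAm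
    have h2 : Z + Z ≤ 2 * (∫⁻ x in A, g x) + Z := by
      calc Z + Z = 2 * (∫⁻ x in A, g x) + 2 * ∫⁻ x in Aᶜ, g x := by
            rw [← two_mul, ← h1, mul_add]
        _ ≤ _ := by gcongr
    exact (ENNReal.add_le_add_iff_right hZtop).1 h2
  set R := √(96 * l) / t with hR
  have hR2 : R ^ 2 = 96 * l / t ^ 2 := by
    rw [hR, div_pow, Real.sq_sqrt (by positivity)]
  have hR0 : 0 ≤ R := by positivity
  let S : V → Set V := fun y => {x | x - R • (y - c) ∈ A}
  have hSm : ∀ y, MeasurableSet (S y) := fun y => (measurable_sub_const _) hAm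
  have hdisj : Set.PairwiseDisjoint (T : Set V) S := by
    intro y hy y' hy' hne
    refine Set.disjoint_left.2 fun z hz hz' => hsep y hy y' hy' hne ?_
    have h1 : F (R • (y - y')) ≤ 4 * (24 * l : ℝ) ^ l := by
      have e3 : R • (y - y') = (z - R • (y' - c)) - (z - R • (y - c)) := by
        simp only [smul_sub]; abel
      rw [e3]
      calc F ((z - R • (y' - c)) - (z - R • (y - c)))
          ≤ ∑ i, lam i * (2 ^ (2 * l - 1) * (inner ℝ (z - R • (y' - c)) (e i) ^ (2 * l) +
              inner ℝ (z - R • (y - c)) (e i) ^ (2 * l))) := by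
            refine Finset.sum_le_sum fun i _ => mul_le_mul_of_nonneg_left ?_ (hlam i)
            rw [inner_sub_left, sub_eq_add_neg]
            refine (Even.add_pow_le (even_two_mul l)).trans ?_
            rw [(even_two_mul l).neg_pow]
        _ = 2 ^ (2 * l - 1) * (F (z - R • (y' - c)) + F (z - R • (y - c))) := by
            simp only [hF]
            rw [← Finset.sum_add_distrib, Finset.mul_sum]
            exact Finset.sum_congr rfl fun i _ => by ring
        _ ≤ 2 ^ (2 * l - 1) * (4 * K + 4 * K) := by
            gcongr
            · exact hz'
            · exact hz
        _ = 2 ^ (2 * l) * (4 * K) := by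
            obtain ⟨k, rfl⟩ : ∃ k, l = k + 1 := ⟨l - 1, by omega⟩
            have : 2 * (k + 1) - 1 = 2 * k + 1 := by omega
            rw [this]; ring
        _ = _ := by
            have : (24 * l : ℝ) ^ l = 2 ^ (2 * l) * K := by
              rw [hK, pow_mul, ← mul_pow]; ring
            rw [this]; ring
    have h2 : F (R • (y - y')) = (96 * l : ℝ) ^ l / t ^ (2 * l) * F (y - y') := by
      simp only [hF]
      rw [Finset.mul_sum]
      refine Finset.sum_congr rfl fun i _ => ?_
      rw [real_inner_smul_left, mul_pow, pow_mul R, hR2, div_pow, ← pow_mul]; ring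
    have h3 : 4 * (24 * l : ℝ) ^ l ≤ (96 * l : ℝ) ^ l := by
      have e4 : (96 * l : ℝ) ^ l = 4 ^ l * (24 * l) ^ l := by rw [← mul_pow]; ring
      rw [e4]
      gcongr
      exact le_self_pow₀ (by norm_num) (by omega)
    have h4 : (96 * l : ℝ) ^ l / t ^ (2 * l) * F (y - y') ≤ (96 * l : ℝ) ^ l :=
      h2 ▸ h1.trans h3
    rw [div_mul_eq_mul_div, div_le_iff₀ (by positivity)] at h4
    exact le_of_mul_le_mul_left h4 (by positivity)
  set q := Real.exp (-(48 * l * ρ ^ 2 / t ^ 2)) with hq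
  have hkey : (T.card : ENNReal) * (ENNReal.ofReal q * ∫⁻ x in A, g x) ≤ Z := by
    calc _ = ∑ y ∈ T, ENNReal.ofReal q * ∫⁻ x in A, g x := by simp
      _ ≤ ∑ y ∈ T, ∫⁻ x in S y, g x := by
          refine Finset.sum_le_sum fun y hy => ?_
          refine le_trans ?_ (setLIntegral_gaussian_translate_ge hAm hAsymm (R • (y - c)))
          gcongr
          rw [norm_smul, mul_pow, Real.norm_eq_abs, sq_abs, hR2]
          have h5 : ‖y - c‖ ^ 2 ≤ ρ ^ 2 := pow_le_pow_left₀ (norm_nonneg _) (hT y hy) 2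
          have e5 : 48 * (l : ℝ) * ρ ^ 2 / t ^ 2 = 96 * l / t ^ 2 * ρ ^ 2 / 2 := by ring
          rw [hq, e5, neg_div]
          gcongr
      _ = ∫⁻ x in ⋃ y ∈ T, S y, g x := by
          rw [lintegral_biUnion_finset hdisj fun y _ => hSm y]
      _ ≤ Z := setLIntegral_le_lintegral _ _
  have h6 : (T.card : ENNReal) * ENNReal.ofReal q * Z ≤ 2 * Z := by
    calc _ ≤ (T.card : ENNReal) * ENNReal.ofReal q * (2 * ∫⁻ x in A, g x) := by gcongr
      _ = 2 * ((T.card : ENNReal) * (ENNReal.ofReal q * ∫⁻ x in A, g x)) := by ring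
      _ ≤ _ := by gcongr
  have h7 := (ENNReal.mul_le_mul_iff_left hZ0 hZtop).1 h6
  have h8 : (T.card : ℝ) * q ≤ 2 := by
    have := ENNReal.toReal_mono (by simp) h7
    rwa [ENNReal.toReal_mul, ENNReal.toReal_natCast, ENNReal.toReal_ofReal (Real.exp_pos _).le,
      ENNReal.toReal_ofNat] at this
  rw [hq, Real.exp_neg, ← div_eq_mul_inv, div_le_iff₀ (Real.exp_pos _)] at h8
  exact h8

end Gaussian

section Lewis

variable {V : Type*} [NormedAddCommGroup V] [InnerProductSpace ℝ V] [FiniteDimensional ℝ V]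

/-- A linear image of a spanning family that maximizes the determinant is in Lewis position. -/
theorem exists_lewis_map {N : ℕ} (b : Fin N → V)
    (hb : ∀ y, (∀ i, inner ℝ (b i) y = 0) → y = 0) {p : ℝ} (hp : 1 ≤ p) (hp2 : p ≤ 2) :
    ∃ T : V →L[ℝ] V, Function.Surjective T ∧ ∑ i, ‖T (b i)‖ ^ p ≤ 1 ∧
      ∀ z, ‖z‖ = 1 → 1 / 2 ≤ Module.finrank ℝ V *
        ∑ i, ‖T (b i)‖ ^ p * inner ℝ (‖T (b i)‖⁻¹ • T (b i)) z ^ 2 := by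
  have hp0 : 0 < p := by linarith
  set m := Module.finrank ℝ V with hm
  set Φ : (V →L[ℝ] V) → ℝ := fun T => ∑ i, ‖T (b i)‖ ^ p with hΦ
  have hΦc : Continuous Φ := by
    refine continuous_finsetSum _ fun i _ => ?_
    refine Continuous.rpow_const ?_ fun _ => Or.inr hp0.le
    fun_prop
  have hΦ0 : ∀ T, 0 ≤ Φ T := fun T => Finset.sum_nonneg fun i _ => by positivity
  have hΦs : ∀ (c : ℝ) (T : V →L[ℝ] V), 0 ≤ c → Φ (c • T) = c ^ p * Φ T := fun c T hc => by
    simp only [hΦ]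
    rw [Finset.mul_sum]
    refine Finset.sum_congr rfl fun i _ => ?_
    rw [smul_apply, norm_smul, Real.norm_eq_abs, abs_of_nonneg hc,
      Real.mul_rpow hc (norm_nonneg _)]
  have hspan : Submodule.span ℝ (Set.range b) = ⊤ := by
    rw [← Submodule.orthogonal_eq_bot_iff, Submodule.eq_bot_iff]
    intro y hy
    exact hb y fun i => hy (b i) (Submodule.subset_span ⟨i, rfl⟩)
  set K : Set (V →L[ℝ] V) := {T | Φ T ≤ 1} with hK
  have hKc : IsCompact K := by
    refine Metric.isCompact_of_isClosed_isBounded (isClosed_le hΦc continuous_const) ?_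
    let ev : (V →L[ℝ] V) →ₗ[ℝ] (Fin N → V) :=
      { toFun := fun T i => T (b i)
        map_add' := fun S T => rfl
        map_smul' := fun c T => rfl }
    have hinj : Function.Injective ev := by
      intro S T h
      apply ContinuousLinearMap.coe_inj.1
      refine LinearMap.ext_on_range hspan fun i => ?_
      exact congrFun h i
    obtain ⟨C, -, hC⟩ := ev.exists_antilipschitzWith (LinearMap.ker_eq_bot_of_injective hinj)
    refine (hC.isBounded_preimage (Metric.isBounded_closedBall (x := 0) (r := 1))).subset ?_
    intro T hT
    rw [Set.mem_preimage, mem_closedBall_zero_iff, pi_norm_le_iff_of_nonneg zero_le_one]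
    intro i
    have h1 : ‖T (b i)‖ ^ p ≤ 1 :=
      (Finset.single_le_sum (f := fun i => ‖T (b i)‖ ^ p) (fun i _ => by positivity)
        (Finset.mem_univ i)).trans hT
    by_contra h
    exact absurd (Real.one_lt_rpow (not_le.1 h) hp0) (not_lt.2 h1)
  obtain ⟨T, hTK, hTmax⟩ := hKc.exists_isMaxOn (f := fun T : V →L[ℝ] V => |T.det|)
    ⟨0, by simp [hK, hΦ, Real.zero_rpow hp0.ne']⟩
    (ContinuousLinearMap.continuous_det.abs.continuousOn)
  have hscale : ∀ S : V →L[ℝ] V, ∀ σ : ℝ, 0 < σ → Φ S ≤ σ → |S.det| ≤ σ ^ (m / p : ℝ) * |T.det| := by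
    intro S σ hσ hS
    set c := σ ^ (-(1 / p)) with hc
    have hc0 : 0 < c := by positivity
    have hmem : c • S ∈ K := by
      simp only [hK, Set.mem_ofPred_eq]
      rw [hΦs c S hc0.le, hc, ← Real.rpow_mul hσ.le]
      have : -(1 / p) * p = -1 := by field_simp
      rw [this, Real.rpow_neg_one, inv_mul_le_iff₀ hσ]
      linarith
    have h1 : |(c • S).det| ≤ |T.det| := hTmax hmem
    have h2 : (c • S).det = c ^ m * S.det := by
      simp [ContinuousLinearMap.det, LinearMap.det_smul, hm]
    rw [h2, abs_mul, abs_of_pos (by positivity)] at h1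
    have h3 : c ^ m = (σ ^ (m / p : ℝ))⁻¹ := by
      rw [hc, ← Real.rpow_natCast, ← Real.rpow_mul hσ.le, ← Real.rpow_neg hσ.le]
      congr 1; ring
    rwa [h3, inv_mul_le_iff₀ (by positivity)] at h1
  have hdet : 0 < |T.det| := by
    have h1 := hscale (ContinuousLinearMap.id ℝ V) (Φ (ContinuousLinearMap.id ℝ V) + 1)
      (by linarith [hΦ0 (ContinuousLinearMap.id ℝ V)]) (by linarith)
    have h2 : (ContinuousLinearMap.id ℝ V).det = 1 := by
      simp [ContinuousLinearMap.det]
    rw [h2, abs_one] at h1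
    by_contra h
    have h3 : |T.det| = 0 := le_antisymm (not_lt.1 h) (abs_nonneg _)
    rw [h3, mul_zero] at h1
    linarith
  refine ⟨T, ?_, hTK, ?_⟩
  · have h0 : LinearMap.det (T : V →ₗ[ℝ] V) ≠ 0 := abs_pos.1 hdet
    exact (LinearMap.equivOfDetNeZero (T : V →ₗ[ℝ] V) h0).surjective
  intro z hz
  set Q := ∑ i, ‖T (b i)‖ ^ p * inner ℝ (‖T (b i)‖⁻¹ • T (b i)) z ^ 2 with hQ
  have hQ0 : 0 ≤ Q := Finset.sum_nonneg fun i _ => by positivity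
  set s : ℝ := √2 - 1 with hs
  have h2s : √2 ^ 2 = (2 : ℝ) := Real.sq_sqrt (by norm_num)
  let R : V →L[ℝ] V := LinearMap.toContinuousLinearMap
    (LinearMap.transvection ((s • innerSL ℝ z : V →L[ℝ] ℝ) : V →ₗ[ℝ] ℝ) z)
  have hR : ∀ v, R v = v + (s * inner ℝ z v) • z := fun v => by
    simp [R, LinearMap.transvection.apply]
  have hRdet : R.det = √2 := by
    have : LinearMap.det (LinearMap.transvection ((s • innerSL ℝ z : V →L[ℝ] ℝ) : V →ₗ[ℝ] ℝ) z)
        = √2 := by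
      rw [LinearMap.transvection.det]
      simp [hz, hs]
    simpa [R, ContinuousLinearMap.det] using this
  have hpt : ∀ v : V, ‖R v‖ ^ p ≤ ‖v‖ ^ p + p / 2 * (‖v‖ ^ p * inner ℝ (‖v‖⁻¹ • v) z ^ 2) := by
    intro v
    by_cases hv : v = 0
    · simp [hv, hR]
    have hv' : 0 < ‖v‖ := norm_pos_iff.2 hv
    have h1 : ‖R v‖ ^ 2 = ‖v‖ ^ 2 * (1 + inner ℝ (‖v‖⁻¹ • v) z ^ 2) := by
      rw [hR, norm_add_sq_real, norm_smul, inner_smul_right, real_inner_smul_left, hz,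
        real_inner_comm v z, Real.norm_eq_abs, mul_one, sq_abs, mul_pow, mul_pow]
      field_simp
      rw [hs]
      nlinarith
    have h3 : ∀ w : V, ‖w‖ ^ p = (‖w‖ ^ 2) ^ (p / 2) := fun w => by
      rw [← Real.rpow_natCast, ← Real.rpow_mul (norm_nonneg _)]
      congr 1; push_cast; ring
    rw [h3 (R v), h1, Real.mul_rpow (by positivity) (by positivity), ← h3 v]
    have h4 := rpow_one_add_le_one_add_mul_self (s := inner ℝ (‖v‖⁻¹ • v) z ^ 2) (p := p / 2)
      (by nlinarith [sq_nonneg (inner ℝ (‖v‖⁻¹ • v) z : ℝ)]) (by positivity) (by linarith)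
    have h5 : 0 ≤ ‖v‖ ^ p := by positivity
    nlinarith
  have hΦR : Φ (R.comp T) ≤ 1 + p / 2 * Q := by
    calc Φ (R.comp T) ≤ ∑ i, (‖T (b i)‖ ^ p + p / 2 *
          (‖T (b i)‖ ^ p * inner ℝ (‖T (b i)‖⁻¹ • T (b i)) z ^ 2)) :=
          Finset.sum_le_sum fun i _ => hpt (T (b i))
      _ = Φ T + p / 2 * Q := by rw [Finset.sum_add_distrib, ← Finset.mul_sum]
      _ ≤ _ := by
        have : Φ T ≤ 1 := hTK
        linarith
  have h6 := hscale (R.comp T) (1 + p / 2 * Q) (by positivity) hΦR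
  have h7 : (R.comp T).det = √2 * T.det := by
    rw [← hRdet]
    simp [ContinuousLinearMap.det]
  rw [h7, abs_mul, abs_of_nonneg (Real.sqrt_nonneg 2)] at h6
  have h8 := le_of_mul_le_mul_right h6 hdet
  have h9 : (1 + p / 2 * Q) ^ (m / p : ℝ) ≤ Real.exp (m * Q / 2) := by
    calc (1 + p / 2 * Q) ^ (m / p : ℝ) ≤ (Real.exp (p / 2 * Q)) ^ (m / p : ℝ) := by
          gcongr
          linarith [Real.add_one_le_exp (p / 2 * Q)]
      _ = _ := by
          rw [← Real.exp_mul]; congr 1; field_simp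
  have h10 : Real.log √2 ≤ m * Q / 2 := by
    rw [← Real.exp_le_exp, Real.exp_log (by positivity)]
    exact h8.trans h9
  rw [Real.log_sqrt (by norm_num)] at h10
  linarith [Real.log_two_gt_d9]

end Lewis

/-- Lewis' change of density for a finite-dimensional subspace of `ℓ_p^N`. -/
theorem exists_lewis_density {N : ℕ} (E : Submodule ℝ (Fin N → ℝ)) {p : ℝ} (hp : 1 ≤ p)
    (hp2 : p ≤ 2) :
    ∃ (lam : Fin N → ℝ) (e : Fin N → EuclideanSpace ℝ (Fin (Module.finrank ℝ E))),
      (∀ i, 0 ≤ lam i) ∧ ∑ i, lam i ≤ 1 ∧ (∀ i, ‖e i‖ ≤ 1) ∧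
      (∀ y, ‖y‖ ^ 2 ≤ 2 * Module.finrank ℝ E * ∑ i, lam i * inner ℝ y (e i) ^ 2) ∧
      ∀ f ∈ E, ∃ y, ∀ i, |f i| ^ p = lam i * |inner ℝ y (e i)| ^ p := by
  set V := EuclideanSpace ℝ (Fin (Module.finrank ℝ E))
  have hV : Module.finrank ℝ V = Module.finrank ℝ E := by simp [V]
  let A : V ≃ₗ[ℝ] E := LinearEquiv.ofFinrankEq V E hV
  let b : Fin N → V := fun i => (InnerProductSpace.toDual ℝ V).symm
    (LinearMap.toContinuousLinearMap
      ((LinearMap.proj i : (Fin N → ℝ) →ₗ[ℝ] ℝ) ∘ₗ E.subtype ∘ₗ (A : V →ₗ[ℝ] E)))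
  have hb : ∀ i y, inner ℝ (b i) y = (A y : Fin N → ℝ) i := fun i y => by
    simp only [b]
    rw [InnerProductSpace.toDual_symm_apply]
    rfl
  obtain ⟨T, hTs, hT1, hT2⟩ := exists_lewis_map b (fun y hy => by
    have : A y = 0 := Subtype.ext (funext fun i => by rw [← hb]; exact hy i)
    simpa using this) hp hp2
  rw [hV] at hT2
  refine ⟨fun i => ‖T (b i)‖ ^ p, fun i => ‖T (b i)‖⁻¹ • T (b i), fun i => by positivity, hT1,
    fun i => ?_, fun y => ?_, fun f hf => ?_⟩
  · rw [norm_smul, norm_inv, norm_norm]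
    exact inv_mul_le_one
  · by_cases hy : y = 0
    · simp [hy]
    have hy' : 0 < ‖y‖ := norm_pos_iff.2 hy
    have h := hT2 (‖y‖⁻¹ • y) (by rw [norm_smul, norm_inv, norm_norm, inv_mul_cancel₀ hy'.ne'])
    have e1 : ∑ i, ‖T (b i)‖ ^ p * inner ℝ (‖T (b i)‖⁻¹ • T (b i)) (‖y‖⁻¹ • y) ^ 2 =
        (‖y‖ ^ 2)⁻¹ * ∑ i, ‖T (b i)‖ ^ p * inner ℝ y (‖T (b i)‖⁻¹ • T (b i)) ^ 2 := by
      rw [Finset.mul_sum]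
      refine Finset.sum_congr rfl fun i _ => ?_
      rw [real_inner_smul_right, real_inner_comm, mul_pow, inv_pow]
      ring
    rw [e1, mul_left_comm, le_inv_mul_iff₀ (by positivity)] at h
    linarith
  · have hadj : Function.Surjective (ContinuousLinearMap.adjoint T) := by
      have : Function.Injective ((ContinuousLinearMap.adjoint T : V →L[ℝ] V) : V →ₗ[ℝ] V) := by
        rw [injective_iff_map_eq_zero]
        intro y hy
        obtain ⟨x, hx⟩ := hTs y
        have h : inner ℝ x (ContinuousLinearMap.adjoint T y) = 0 := by
          have : ContinuousLinearMap.adjoint T y = 0 := hy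
          rw [this, inner_zero_right]
        rw [ContinuousLinearMap.adjoint_inner_right, hx] at h
        exact inner_self_eq_zero.1 h
      exact LinearMap.injective_iff_surjective.1 this
    obtain ⟨y, hy⟩ := hadj (A.symm ⟨f, hf⟩)
    refine ⟨y, fun i => ?_⟩
    have h1 : f i = inner ℝ (T (b i)) y := by
      rw [← ContinuousLinearMap.adjoint_inner_right, hy, hb]
      simp
    have hp0 : p ≠ 0 := by linarith
    by_cases h0 : T (b i) = 0
    · simp [h1, h0, Real.zero_rpow hp0]
    have h0' : 0 < ‖T (b i)‖ := norm_pos_iff.2 h0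
    beta_reduce
    rw [h1, real_inner_smul_right, real_inner_comm, ← Real.mul_rpow (norm_nonneg _) (abs_nonneg _),
      abs_mul, abs_of_pos (inv_pos.2 h0'), mul_inv_cancel_left₀ h0'.ne']

section Nets

variable {V : Type*} [NormedAddCommGroup V] [InnerProductSpace ℝ V] {ι : Type*} [Fintype ι]

/-- The `2l`-th moment of the coordinates `⟪x, e i⟫` with weights `lam i`. -/
noncomputable def evenMoment (lam : ι → ℝ) (e : ι → V) (l : ℕ) (x : V) : ℝ :=
  ∑ i, lam i * inner ℝ x (e i) ^ (2 * l)

/-- The unit ball of the weighted `L_p` norm of the coordinates `⟪x, e i⟫`. -/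
def coordBall (lam : ι → ℝ) (e : ι → V) (p : ℝ) : Set V :=
  {y | ∑ i, lam i * |inner ℝ y (e i)| ^ p ≤ 1}

theorem abs_inner_le_norm_of_norm_le_one {e : V} (he : ‖e‖ ≤ 1) (x : V) :
    |inner ℝ x e| ≤ ‖x‖ :=
  (abs_real_inner_le_norm x e).trans (mul_le_of_le_one_right (norm_nonneg x) he)

theorem evenMoment_sub_comm (lam : ι → ℝ) (e : ι → V) (l : ℕ) (x y : V) :
    evenMoment lam e l (x - y) = evenMoment lam e l (y - x) := by
  unfold evenMoment
  refine Finset.sum_congr rfl fun i _ => ?_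
  rw [← neg_sub y x, inner_neg_left, (even_two_mul l).neg_pow]

theorem evenMoment_self_sub (lam : ι → ℝ) (e : ι → V) {l : ℕ} (hl : 1 ≤ l) (x : V) :
    evenMoment lam e l (x - x) = 0 := by
  have : 2 * l ≠ 0 := by omega
  simp [evenMoment, this]

theorem evenMoment_le_norm_pow {lam : ι → ℝ} {e : ι → V} (hlam : ∀ i, 0 ≤ lam i)
    (hsum : ∑ i, lam i ≤ 1) (he : ∀ i, ‖e i‖ ≤ 1) (l : ℕ) (x : V) :
    evenMoment lam e l x ≤ ‖x‖ ^ (2 * l) := by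
  calc evenMoment lam e l x ≤ ∑ i, lam i * ‖x‖ ^ (2 * l) := by
        refine Finset.sum_le_sum fun i _ => mul_le_mul_of_nonneg_left ?_ (hlam i)
        rw [← (even_two_mul l).pow_abs]
        exact pow_le_pow_left₀ (abs_nonneg _) (abs_inner_le_norm_of_norm_le_one (he i) x) _
    _ = (∑ i, lam i) * ‖x‖ ^ (2 * l) := by rw [Finset.sum_mul]
    _ ≤ _ := mul_le_of_le_one_left (by positivity) hsum

theorem sq_le_rpow_mul_add {A h p : ℝ} (hA : 0 < A) (hp2 : p ≤ 2) {l : ℕ} (hl : 1 ≤ l) :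
    h ^ 2 ≤ A ^ (2 - p) * |h| ^ p + A ^ 2 * (h / A) ^ (2 * l) := by
  have h2 : 0 ≤ A ^ (2 - p) * |h| ^ p := by positivity
  have h3 : 0 ≤ A ^ 2 * (h / A) ^ (2 * l) :=
    mul_nonneg (by positivity) ((even_two_mul l).pow_nonneg _)
  rcases le_or_gt |h| A with hle | hlt
  · rcases eq_or_ne h 0 with rfl | h0
    · simpa using add_nonneg h2 h3
    have h1 : h ^ 2 = |h| ^ (2 - p) * |h| ^ p := by
      rw [← Real.rpow_add (abs_pos.2 h0), sub_add_cancel, Real.rpow_two, sq_abs]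
    have : |h| ^ (2 - p) ≤ A ^ (2 - p) := by
      apply Real.rpow_le_rpow (abs_nonneg _) hle; linarith
    have h4 : h ^ 2 ≤ A ^ (2 - p) * |h| ^ p := by rw [h1]; gcongr
    linarith
  · have h1 : 1 ≤ (h / A) ^ 2 := by
      rw [div_pow, one_le_div (by positivity), ← sq_abs h]
      exact pow_le_pow_left₀ hA.le hlt.le 2
    have h4 : (h / A) ^ 2 ≤ (h / A) ^ (2 * l) := by
      rw [pow_mul]; exact le_self_pow₀ h1 (by omega)
    have h5 : h ^ 2 = A ^ 2 * (h / A) ^ 2 := by field_simp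
    have h6 : h ^ 2 ≤ A ^ 2 * (h / A) ^ (2 * l) := by rw [h5]; gcongr
    linarith

theorem abs_sub_rpow_le {p : ℝ} (hp : 1 ≤ p) (hp2 : p ≤ 2) (a b : ℝ) :
    |a - b| ^ p ≤ 2 * (|a| ^ p + |b| ^ p) := by
  have h1 : |a - b| ≤ |a| + |b| := abs_sub a b
  have h2 : (|a| + |b|) ^ p ≤ 2 ^ (p - 1) * (|a| ^ p + |b| ^ p) := by
    simpa using NNReal.coe_le_coe.2 (NNReal.rpow_add_le_mul_rpow_add_rpow ‖a‖₊ ‖b‖₊ hp)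
  have h3 : (2 : ℝ) ^ (p - 1) ≤ 2 := by
    have := Real.rpow_le_rpow_of_exponent_le (by norm_num : (1 : ℝ) ≤ 2)
      (by linarith : p - 1 ≤ 1)
    rwa [Real.rpow_one] at this
  calc |a - b| ^ p ≤ (|a| + |b|) ^ p := by gcongr
    _ ≤ 2 ^ (p - 1) * (|a| ^ p + |b| ^ p) := h2
    _ ≤ _ := by gcongr

theorem norm_le_of_mem_coordBall {lam : ι → ℝ} {e : ι → V} (hlam : ∀ i, 0 ≤ lam i)
    (he : ∀ i, ‖e i‖ ≤ 1) {p : ℝ} (hp : 1 ≤ p) (hp2 : p ≤ 2) {n M : ℝ} (hn : 0 < n)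
    (hM : 0 < M) (hMn : M ^ p = 2 * n)
    (hE : ∀ y, ‖y‖ ^ 2 ≤ 2 * n * ∑ i, lam i * inner ℝ y (e i) ^ 2) {y : V}
    (hy : y ∈ coordBall lam e p) : ‖y‖ ≤ M := by
  rcases eq_or_ne y 0 with rfl | h0
  · simpa using hM.le
  have hy0 : 0 < ‖y‖ := norm_pos_iff.2 h0
  have h1 : ∑ i, lam i * inner ℝ y (e i) ^ 2 ≤ ‖y‖ ^ (2 - p) := by
    calc _ ≤ ∑ i, ‖y‖ ^ (2 - p) * (lam i * |inner ℝ y (e i)| ^ p) := by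
          refine Finset.sum_le_sum fun i _ => ?_
          rw [mul_left_comm]
          refine mul_le_mul_of_nonneg_left ?_ (hlam i)
          rcases eq_or_ne (inner ℝ y (e i)) 0 with h | h
          · rw [h]; simp; positivity
          have h3 : inner ℝ y (e i) ^ 2 = |inner ℝ y (e i)| ^ (2 - p) * |inner ℝ y (e i)| ^ p := by
            rw [← Real.rpow_add (abs_pos.2 h), sub_add_cancel, Real.rpow_two, sq_abs]
          rw [h3]
          have h4 := Real.rpow_le_rpow (abs_nonneg _)
            (abs_inner_le_norm_of_norm_le_one (he i) y) (by linarith : 0 ≤ 2 - p)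
          gcongr
      _ = ‖y‖ ^ (2 - p) * ∑ i, lam i * |inner ℝ y (e i)| ^ p := by rw [Finset.mul_sum]
      _ ≤ _ := mul_le_of_le_one_right (by positivity) hy
  have h2 : ‖y‖ ^ p * ‖y‖ ^ (2 - p) ≤ M ^ p * ‖y‖ ^ (2 - p) := by
    rw [← Real.rpow_add hy0, add_sub_cancel, Real.rpow_two, hMn]
    exact (hE y).trans (by gcongr)
  have h3 := le_of_mul_le_mul_right h2 (by positivity)
  exact (Real.rpow_le_rpow_iff hy0.le hM.le (by linarith)).1 h3

theorem norm_sub_sq_le_of_evenMoment_le {lam : ι → ℝ} {e : ι → V} (hlam : ∀ i, 0 ≤ lam i)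
    {p : ℝ} (hp : 1 ≤ p) (hp2 : p ≤ 2) {n : ℝ} (hn : 0 < n)
    (hE : ∀ y, ‖y‖ ^ 2 ≤ 2 * n * ∑ i, lam i * inner ℝ y (e i) ^ 2) {l : ℕ} (hl : 2 ≤ l)
    (hnl : n ≤ 2 ^ l) {A : ℝ} (hA : 0 < A) (hAn : A ^ p ≤ 32 * n) {y g : V}
    (hy : y ∈ coordBall lam e p) (hg : g ∈ coordBall lam e p)
    (hyg : evenMoment lam e l (y - g) ≤ (A / 4) ^ (2 * l)) :
    ‖y - g‖ ^ 2 ≤ 16 * n * A ^ (2 - p) := by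
  have h1 : ∑ i, lam i * inner ℝ (y - g) (e i) ^ 2 ≤ 8 * A ^ (2 - p) := by
    calc _ ≤ ∑ i, (A ^ (2 - p) * 2 * (lam i * |inner ℝ y (e i)| ^ p
            + lam i * |inner ℝ g (e i)| ^ p)
          + A ^ 2 / A ^ (2 * l) * (lam i * inner ℝ (y - g) (e i) ^ (2 * l))) := by
          refine Finset.sum_le_sum fun i _ => ?_
          have h2 := sq_le_rpow_mul_add (h := inner ℝ (y - g) (e i)) hA hp2 (by omega : 1 ≤ l)
          have h3 := abs_sub_rpow_le hp hp2 (inner ℝ y (e i)) (inner ℝ g (e i))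
          rw [← inner_sub_left] at h3
          have h4 : 0 ≤ A ^ (2 - p) := by positivity
          have h5 := mul_le_mul_of_nonneg_left (h2.trans
            (add_le_add_left (mul_le_mul_of_nonneg_left h3 h4) _)) (hlam i)
          refine h5.trans (le_of_eq ?_)
          rw [div_pow]; ring
      _ = A ^ (2 - p) * 2 * ((∑ i, lam i * |inner ℝ y (e i)| ^ p)
            + ∑ i, lam i * |inner ℝ g (e i)| ^ p)
          + A ^ 2 / A ^ (2 * l) * evenMoment lam e l (y - g) := by
          rw [Finset.sum_add_distrib, ← Finset.mul_sum, ← Finset.mul_sum, Finset.sum_add_distrib]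
          rfl
      _ ≤ A ^ (2 - p) * 2 * (1 + 1) + A ^ 2 / A ^ (2 * l) * (A / 4) ^ (2 * l) := by
          gcongr
          · exact hy
          · exact hg
      _ ≤ A ^ (2 - p) * 2 * (1 + 1) + A ^ (2 - p) * 4 := by
          refine add_le_add_right ?_ _
          have e0 : A ^ (2 - p) * A ^ p = A ^ 2 := by
            rw [← Real.rpow_add hA, sub_add_cancel, Real.rpow_two]
          have e1 : A ^ 2 / A ^ (2 * l) * (A / 4) ^ (2 * l) = A ^ (2 - p) * (A ^ p / 16 ^ l) := by
            rw [mul_div_assoc', e0, div_pow, pow_mul 4]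
            field_simp; norm_num
          rw [e1]
          refine mul_le_mul_of_nonneg_left ?_ (by positivity)
          rw [div_le_iff₀ (by positivity)]
          have e2 : (16 : ℝ) ^ l = 2 ^ l * 8 ^ l := by rw [← mul_pow]; norm_num
          have e3 : (8 : ℝ) ^ 2 ≤ 8 ^ l := pow_le_pow_right₀ (by norm_num) hl
          rw [e2]
          nlinarith [pow_pos (two_pos : (0 : ℝ) < 2) l]
      _ = _ := by ring
  calc _ ≤ 2 * n * ∑ i, lam i * inner ℝ (y - g) (e i) ^ 2 := hE _
    _ ≤ 2 * n * (8 * A ^ (2 - p)) := by gcongr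
    _ = _ := by ring

variable [FiniteDimensional ℝ V]

theorem exists_net_refine {lam : ι → ℝ} {e : ι → V} (hlam : ∀ i, 0 ≤ lam i)
    (hsum : ∑ i, lam i ≤ 1) (he : ∀ i, ‖e i‖ ≤ 1)
    {p : ℝ} (hp : 1 ≤ p) (hp2 : p ≤ 2) {n : ℝ} (hn : 0 < n)
    (hE : ∀ y, ‖y‖ ^ 2 ≤ 2 * n * ∑ i, lam i * inner ℝ y (e i) ^ 2) {l : ℕ} (hl : 2 ≤ l)
    (hnl : n ≤ 2 ^ l) {A : ℝ} (hA : 0 < A) (hAn : A ^ p ≤ 32 * n) {g : V}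
    (hg : g ∈ coordBall lam e p) :
    ∃ T : Finset V, ↑T ⊆ coordBall lam e p ∧
      (T.card : ℝ) ≤ 2 * Real.exp (49152 * l * n / A ^ p) ∧
      ∀ y ∈ coordBall lam e p, evenMoment lam e l (y - g) ≤ (A / 4) ^ (2 * l) →
        ∃ g' ∈ T, evenMoment lam e l (y - g') ≤ (A / 8) ^ (2 * l) := by
  obtain ⟨T, hT1, hT2, hT3⟩ := exists_net_of_card_le
    {y | y ∈ coordBall lam e p ∧ evenMoment lam e l (y - g) ≤ (A / 4) ^ (2 * l)}
    (fun x y => evenMoment lam e l (x - y) ≤ (A / 8) ^ (2 * l))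
    (fun x => by rw [evenMoment_self_sub _ _ (by omega)]; positivity)
    (fun x y h => by rwa [evenMoment_sub_comm])
    (2 * Real.exp (49152 * l * n / A ^ p)) (fun T hT hsep => by
      borelize V
      have h := card_le_of_gaussian_separated hlam hsum he (l := l) (by omega) (c := g)
        (ρ := √(16 * n * A ^ (2 - p))) (t := A / 8) (by positivity) (T := T)
        (fun y hy => Real.le_sqrt_of_sq_le
          (norm_sub_sq_le_of_evenMoment_le hlam hp hp2 hn hE hl hnl hA hAn
            (hT hy).1 hg (hT hy).2)) hsep
      refine h.trans (le_of_eq ?_)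
      rw [Real.sq_sqrt (by positivity)]
      congr 2
      rw [Real.rpow_sub hA, Real.rpow_two]
      field_simp
      norm_num)
  exact ⟨T, fun y hy => (hT1 hy).1, hT2, fun y hy hyg => hT3 y ⟨hy, hyg⟩⟩

/-- Nets of the unit ball in the even moment metric, from iterated Sudakov estimates. -/
theorem exists_net_sudakov {lam : ι → ℝ} {e : ι → V} (hlam : ∀ i, 0 ≤ lam i)
    (hsum : ∑ i, lam i ≤ 1) (he : ∀ i, ‖e i‖ ≤ 1)
    {p : ℝ} (hp : 1 ≤ p) (hp2 : p ≤ 2) {n M : ℝ} (hn : 0 < n)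
    (hM : 0 < M) (hMn : M ^ p = 2 * n)
    (hE : ∀ y, ‖y‖ ^ 2 ≤ 2 * n * ∑ i, lam i * inner ℝ y (e i) ^ 2) {l : ℕ} (hl : 2 ≤ l)
    (hnl : n ≤ 2 ^ l) (j : ℕ) :
    ∃ G : Finset V, ↑G ⊆ coordBall lam e p ∧
      (G.card : ℝ) ≤ Real.exp (7000 * l * ((2 : ℝ) ^ p) ^ j) ∧
      ∀ y ∈ coordBall lam e p, ∃ g ∈ G, evenMoment lam e l (y - g) ≤ (M / 2 ^ j) ^ (2 * l) := by
  classical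
  have h2p : (2 : ℝ) ≤ 2 ^ p := by
    simpa using Real.rpow_le_rpow_of_exponent_le (by norm_num : (1 : ℝ) ≤ 2) hp
  induction j with
  | zero =>
    refine ⟨{0}, ?_, ?_, fun y hy => ⟨0, by simp, ?_⟩⟩
    · simp [coordBall, Real.zero_rpow (by linarith : p ≠ 0)]
    · simp only [Finset.card_singleton, Nat.cast_one]
      exact Real.one_le_exp (by positivity)
    · rw [sub_zero, pow_zero, div_one]
      exact (evenMoment_le_norm_pow hlam hsum he l y).trans (pow_le_pow_left₀ (norm_nonneg _)
        (norm_le_of_mem_coordBall hlam he hp hp2 hn hM hMn hE hy) _)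
  | succ j ih =>
    obtain ⟨G, hG1, hG2, hG3⟩ := ih
    set A := 4 * M / 2 ^ j with hA
    have hA0 : 0 < A := by positivity
    have hAp : A ^ p = 4 ^ p * (2 * n) / (2 ^ p) ^ j := by
      rw [hA, Real.div_rpow (by positivity) (by positivity), Real.mul_rpow (by norm_num) hM.le,
        hMn, ← Real.rpow_natCast, ← Real.rpow_natCast, ← Real.rpow_mul (by norm_num),
        ← Real.rpow_mul (by norm_num), mul_comm p]
    have h4p : (4 : ℝ) ^ p ≤ 16 := by
      have := Real.rpow_le_rpow_of_exponent_le (by norm_num : (1 : ℝ) ≤ 4) hp2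
      norm_num at this; exact this
    have h4p' : (4 : ℝ) ≤ 4 ^ p := by
      simpa using Real.rpow_le_rpow_of_exponent_le (by norm_num : (1 : ℝ) ≤ 4) hp
    have h1j : (1 : ℝ) ≤ (2 ^ p) ^ j := one_le_pow₀ (by linarith)
    have hAn : A ^ p ≤ 32 * n := by
      rw [hAp]
      refine (div_le_self (by positivity) h1j).trans ?_
      nlinarith
    have hAA : 49152 * l * n / A ^ p ≤ 6144 * l * (2 ^ p) ^ j := by
      rw [hAp, div_div_eq_mul_div, div_le_iff₀ (by positivity)]
      have : 0 ≤ (l : ℝ) * n * (2 ^ p) ^ j := by positivity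
      nlinarith
    choose! T hT1 hT2 hT3 using fun g (hg : g ∈ coordBall lam e p) =>
      exists_net_refine hlam hsum he hp hp2 hn hE hl hnl hA0 hAn hg
    refine ⟨G.biUnion T, ?_, ?_, fun y hy => ?_⟩
    · intro x hx
      obtain ⟨g, hg, hx⟩ := Finset.mem_biUnion.1 (Finset.mem_coe.1 hx)
      exact hT1 g (hG1 hg) hx
    · have hL : (1 : ℝ) ≤ l := by exact_mod_cast (by omega : 1 ≤ l)
      calc ((G.biUnion T).card : ℝ) ≤ ∑ g ∈ G, ((T g).card : ℝ) := by
            exact_mod_cast Finset.card_biUnion_le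
        _ ≤ ∑ g ∈ G, 2 * Real.exp (6144 * l * (2 ^ p) ^ j) := by
            refine Finset.sum_le_sum fun g hg => (hT2 g (hG1 hg)).trans ?_
            gcongr
        _ = G.card * (2 * Real.exp (6144 * l * (2 ^ p) ^ j)) := by simp
        _ ≤ Real.exp (7000 * l * (2 ^ p) ^ j) * (Real.exp 1 * Real.exp (6144 * l * (2 ^ p) ^ j)) := by
            gcongr
            linarith [Real.add_one_le_exp 1]
        _ = Real.exp (7000 * l * (2 ^ p) ^ j + (1 + 6144 * l * (2 ^ p) ^ j)) := by
            rw [Real.exp_add, Real.exp_add]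
        _ ≤ _ := by
            rw [Real.exp_le_exp, pow_succ]
            have h3 : 1 ≤ (l : ℝ) * (2 ^ p) ^ j := by nlinarith
            nlinarith
    · obtain ⟨g, hg, hyg⟩ := hG3 y hy
      obtain ⟨g', hg', hyg'⟩ := hT3 g (hG1 hg) y hy (by
        convert hyg using 2; rw [hA]; ring)
      refine ⟨g', Finset.mem_biUnion.2 ⟨g, hg, hg'⟩, ?_⟩
      convert hyg' using 2
      rw [hA, pow_succ]; field_simp; norm_num

/-- Nets of the unit ball in the even moment metric, from volume estimates. -/
theorem exists_net_volume {lam : ι → ℝ} {e : ι → V} (hlam : ∀ i, 0 ≤ lam i) (he : ∀ i, ‖e i‖ ≤ 1)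
    {p : ℝ} (hp : 1 ≤ p) (hp2 : p ≤ 2) {n M : ℝ} (hn : 0 < n)
    (hM : 0 < M) (hMn : M ^ p = 2 * n)
    (hE : ∀ y, ‖y‖ ^ 2 ≤ 2 * n * ∑ i, lam i * inner ℝ y (e i) ^ 2)
    (hV : (Module.finrank ℝ V : ℝ) ≤ n) (j : ℕ) :
    ∃ G : Finset V, ↑G ⊆ coordBall lam e p ∧
      (G.card : ℝ) ≤ Real.exp (n * (j + 2)) ∧
      ∀ y ∈ coordBall lam e p, ∃ g ∈ G, ‖y - g‖ ≤ M / 2 ^ j := by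
  obtain ⟨T, hT1, hT2, hT3⟩ := exists_net_of_card_le (coordBall lam e p)
    (fun x y => ‖x - y‖ ≤ M / 2 ^ j)
    (fun x => by rw [sub_self, norm_zero]; positivity)
    (fun x y h => by rwa [norm_sub_rev])
    (Real.exp (n * (j + 2))) (fun T hT hsep => by
      have h := card_le_of_norm_separated T hM.le (by positivity : 0 < M / 2 ^ j)
        (fun y hy => norm_le_of_mem_coordBall hlam he hp hp2 hn hM hMn hE (hT hy))
        (fun x hx y hy hxy => (not_le.1 (hsep x hx y hy hxy)).le)
      refine h.trans ?_
      have e1 : 2 * M / (M / 2 ^ j) + 1 ≤ 2 ^ (j + 2) := by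
        have : 2 * M / (M / 2 ^ j) = 2 * 2 ^ j := by field_simp
        rw [this, pow_add]
        nlinarith [one_le_pow₀ (by norm_num : (1 : ℝ) ≤ 2) (n := j)]
      have e2 : (2 : ℝ) ^ (j + 2) ≤ Real.exp (j + 2) := by
        have : Real.exp (j + 2 : ℝ) = Real.exp 1 ^ (j + 2) := by
          rw [← Real.exp_nat_mul]; push_cast; ring_nf
        rw [this]
        gcongr
        linarith [Real.add_one_le_exp 1]
      calc _ ≤ Real.exp (j + 2) ^ Module.finrank ℝ V := by
            gcongr
            exact e1.trans e2
        _ = Real.exp (Module.finrank ℝ V * (j + 2)) := by rw [← Real.exp_nat_mul]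
        _ ≤ _ := by gcongr)
  exact ⟨T, hT1, hT2, hT3⟩

end Nets

section Truncation

/-- The `p`-th power of the soft thresholding of `x` at level `t`. -/
noncomputable def truncPow (p t x : ℝ) : ℝ := max (|x| - t) 0 ^ p

theorem abs_rpow_sub_rpow_le {p : ℝ} (hp : 1 ≤ p) (hp2 : p ≤ 2) {a b R : ℝ} (ha : 0 ≤ a)
    (hb : 0 ≤ b) (haR : a ≤ R) (hbR : b ≤ R) :
    |a ^ p - b ^ p| ≤ 2 * R ^ (p - 1) * |a - b| := by
  wlog hab : b ≤ a generalizing a b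
  · rw [abs_sub_comm, abs_sub_comm a]
    exact this hb ha hbR haR (le_of_not_ge hab)
  rcases ha.eq_or_lt with rfl | ha
  · have : b = 0 := le_antisymm hab hb
    subst this
    simp
  have h1 : b ^ p ≤ a ^ p := Real.rpow_le_rpow hb hab (by linarith)
  rw [abs_of_nonneg (by linarith), abs_of_nonneg (by linarith)]
  have h2 := one_add_mul_self_le_rpow_one_add (s := b / a - 1) (p := p)
    (by have : 0 ≤ b / a := by positivity
        linarith) hp
  rw [add_sub_cancel, Real.div_rpow hb ha.le, le_div_iff₀ (by positivity)] at h2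
  have h3 : a ^ p = a ^ (p - 1) * a := by
    rw [← Real.rpow_add_one ha.ne', sub_add_cancel]
  have h4 : a ^ p - b ^ p ≤ p * a ^ (p - 1) * (a - b) := by
    have : (1 + p * (b / a - 1)) * a ^ p = a ^ p - p * a ^ (p - 1) * (a - b) := by
      rw [h3]; field_simp; ring
    linarith
  have h5 : a ^ (p - 1) ≤ R ^ (p - 1) := Real.rpow_le_rpow ha.le haR (by linarith)
  calc _ ≤ p * a ^ (p - 1) * (a - b) := h4
    _ ≤ _ := by gcongr

theorem sq_truncPow_sub_truncPow_le {p : ℝ} (hp : 1 ≤ p) (hp2 : p ≤ 2) {A M f g g' : ℝ}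
    (hA : 0 < A) (hg : |g| ≤ M) (hg' : |g'| ≤ M) {l : ℕ} (hl : 1 ≤ l) :
    (truncPow p (2 * A) g - truncPow p (4 * A) g') ^ 2 ≤
      100 * (A ^ p * |f| ^ p + (M ^ (p - 1)) ^ 2 * A ^ 2 *
        (((f - g) / A) ^ (2 * l) + ((f - g') / (2 * A)) ^ (2 * l))) := by
  set a := max (|g| - 2 * A) 0 with ha
  set b := max (|g'| - 4 * A) 0 with hb
  have ha0 : 0 ≤ a := le_max_right _ _
  have hb0 : 0 ≤ b := le_max_right _ _
  have hM : 0 ≤ M := (abs_nonneg g).trans hg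
  have hT1 : 0 ≤ A ^ p * |f| ^ p := by positivity
  have hT2 : 0 ≤ ((f - g) / A) ^ (2 * l) := (even_two_mul l).pow_nonneg _
  have hT3 : 0 ≤ ((f - g') / (2 * A)) ^ (2 * l) := (even_two_mul l).pow_nonneg _
  have htri : |a - b| ≤ 2 * A + |f - g| + |f - g'| := by
    have h1 : |a - b| ≤ |(|g| - 2 * A) - (|g'| - 4 * A)| := abs_max_sub_max_le_abs _ _ _
    have h2 : |(|g| - 2 * A) - (|g'| - 4 * A)| ≤ |g - g'| + 2 * A := by
      have h3 := abs_abs_sub_abs_le_abs_sub g g'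
      rw [abs_le] at h3 ⊢
      constructor <;> linarith [h3.1, h3.2]
    have h4 : |g - g'| ≤ |f - g| + |f - g'| := by
      have := abs_sub_le g f g'
      rwa [abs_sub_comm g f] at this
    linarith
  change (a ^ p - b ^ p) ^ 2 ≤ _
  have main : ∀ R : ℝ, a ≤ R → b ≤ R → (a ^ p - b ^ p) ^ 2 ≤
      4 * (R ^ (p - 1)) ^ 2 * (2 * A + |f - g| + |f - g'|) ^ 2 := fun R haR hbR => by
    have hR : 0 ≤ R := ha0.trans haR
    have h1 := (abs_rpow_sub_rpow_le hp hp2 ha0 hb0 haR hbR).trans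
      (mul_le_mul_of_nonneg_left htri (by positivity))
    rw [← sq_abs]
    refine (pow_le_pow_left₀ (abs_nonneg _) h1 2).trans (le_of_eq ?_)
    ring
  by_cases hgood : |f - g| ≤ A ∧ |f - g'| ≤ 2 * A
  · obtain ⟨h1, h2⟩ := hgood
    have h3 : |g| ≤ |f| + A := by
      have := abs_sub_abs_le_abs_sub g f
      rw [abs_sub_comm] at this; linarith
    have h4 : |g'| ≤ |f| + 2 * A := by
      have := abs_sub_abs_le_abs_sub g' f
      rw [abs_sub_comm] at this; linarith
    rcases le_or_gt |f| A with hf | hf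
    · have e1 : a = 0 := max_eq_right (by linarith)
      have e2 : b = 0 := max_eq_right (by linarith)
      rw [e1, e2]
      simp
      positivity
    · have haf : a ≤ |f| := max_le (by linarith) (abs_nonneg _)
      have hbf : b ≤ |f| := max_le (by linarith) (abs_nonneg _)
      have hf0 : 0 < |f| := hA.trans hf
      have h5 := main |f| haf hbf
      have h6 : (|f| ^ (p - 1)) ^ 2 * A ^ 2 ≤ A ^ p * |f| ^ p := by
        have e1 : (|f| ^ (p - 1)) ^ 2 * |f| ^ (2 - p) = |f| ^ p := by
          rw [← Real.rpow_natCast, ← Real.rpow_mul hf0.le, ← Real.rpow_add hf0]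
          congr 1; push_cast; ring
        have e2 : A ^ 2 = A ^ p * A ^ (2 - p) := by
          rw [← Real.rpow_add hA, add_sub_cancel, Real.rpow_two]
        have h7 : A ^ (2 - p) ≤ |f| ^ (2 - p) := Real.rpow_le_rpow hA.le hf.le (by linarith)
        calc _ = A ^ p * ((|f| ^ (p - 1)) ^ 2 * A ^ (2 - p)) := by rw [e2]; ring
          _ ≤ A ^ p * ((|f| ^ (p - 1)) ^ 2 * |f| ^ (2 - p)) := by gcongr
          _ = _ := by rw [e1]
      have h8 : (2 * A + |f - g| + |f - g'|) ^ 2 ≤ (5 * A) ^ 2 := by gcongr; linarith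
      calc _ ≤ 4 * (|f| ^ (p - 1)) ^ 2 * (5 * A) ^ 2 := h5.trans (by gcongr)
        _ = 100 * ((|f| ^ (p - 1)) ^ 2 * A ^ 2) := by ring
        _ ≤ _ := by
          have : 0 ≤ (M ^ (p - 1)) ^ 2 * A ^ 2 * (((f - g) / A) ^ (2 * l)
            + ((f - g') / (2 * A)) ^ (2 * l)) := by positivity
          linarith
  · have haM : a ≤ M := max_le (by linarith) hM
    have hbM : b ≤ M := max_le (by linarith) hM
    have h5 := main M haM hbM
    obtain ⟨u, hu1, hu2, hu3, hu4⟩ : ∃ u : ℝ, 1 ≤ u ∧ |f - g| ≤ A * u ∧ |f - g'| ≤ 2 * A * u ∧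
        u ^ (2 * l) ≤ ((f - g) / A) ^ (2 * l) + ((f - g') / (2 * A)) ^ (2 * l) := by
      refine ⟨max |(f - g) / A| |(f - g') / (2 * A)|, ?_, ?_, ?_, ?_⟩
      · rw [not_and_or, not_le, not_le] at hgood
        rcases hgood with h | h
        · refine le_max_of_le_left ?_
          rw [abs_div, abs_of_pos hA, one_le_div hA]; exact h.le
        · refine le_max_of_le_right ?_
          rw [abs_div, abs_of_pos (by linarith : 0 < 2 * A), one_le_div (by linarith)]; exact h.le
      · rw [← div_le_iff₀' hA]
        refine le_max_of_le_left (le_of_eq ?_)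
        rw [abs_div, abs_of_pos hA]
      · rw [← div_le_iff₀' (by linarith)]
        refine le_max_of_le_right (le_of_eq ?_)
        rw [abs_div, abs_of_pos (by linarith : 0 < 2 * A)]
      · rcases max_choice |(f - g) / A| |(f - g') / (2 * A)| with h | h <;>
          rw [h, (even_two_mul l).pow_abs] <;> linarith
    have h8 : (2 * A + |f - g| + |f - g'|) ^ 2 ≤ (5 * (A * u)) ^ 2 := by
      gcongr
      nlinarith
    have h9 : u ^ 2 ≤ u ^ (2 * l) := pow_le_pow_right₀ hu1 (by omega)
    calc _ ≤ 4 * (M ^ (p - 1)) ^ 2 * (5 * (A * u)) ^ 2 := h5.trans (by gcongr)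
      _ = 100 * ((M ^ (p - 1)) ^ 2 * A ^ 2 * u ^ 2) := by ring
      _ ≤ 100 * ((M ^ (p - 1)) ^ 2 * A ^ 2 *
        (((f - g) / A) ^ (2 * l) + ((f - g') / (2 * A)) ^ (2 * l))) := by
        gcongr; linarith
      _ ≤ _ := by linarith

theorem abs_rpow_sub_truncPow_le {p : ℝ} (hp : 1 ≤ p) (hp2 : p ≤ 2) {t M f g : ℝ}
    (ht : 0 ≤ t) (hf : |f| ≤ M) (hg : |g| ≤ M) :
    |(|f| ^ p - truncPow p t g)| ≤ 2 * M ^ (p - 1) * (|f - g| + t) := by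
  have hM : 0 ≤ M := (abs_nonneg g).trans hg
  unfold truncPow
  refine (abs_rpow_sub_rpow_le hp hp2 (abs_nonneg f) (le_max_right _ _) hf
    (max_le (by linarith) hM)).trans ?_
  gcongr
  have h1 : |f| = max |f| 0 := (max_eq_left (abs_nonneg f)).symm
  rw [h1]
  refine (abs_max_sub_max_le_abs _ _ _).trans ?_
  have h3 := abs_abs_sub_abs_le_abs_sub f g
  rw [abs_le] at h3 ⊢
  constructor <;> linarith [h3.1, h3.2]

end Truncation

section Chaining

variable {V : Type*} [NormedAddCommGroup V] [InnerProductSpace ℝ V] {ι : Type*} [Fintype ι]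

/-- The links of the chain have small weighted `L_2` norm. -/
theorem sum_sq_link_le {lam : ι → ℝ} {e : ι → V} (hlam : ∀ i, 0 ≤ lam i)
    (he : ∀ i, ‖e i‖ ≤ 1) {p : ℝ} (hp : 1 ≤ p) (hp2 : p ≤ 2) {n M A : ℝ} (hM : 0 < M)
    (hMn : M ^ p = 2 * n) {l : ℕ} (hl : 2 ≤ l) (hnl : n ≤ 2 ^ l) (hA : 0 < A) (hAM : A ≤ 2 * M)
    {y g g' : V} (hy : y ∈ coordBall lam e p) (hg : ‖g‖ ≤ M) (hg' : ‖g'‖ ≤ M)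
    (hyg : evenMoment lam e l (y - g) ≤ (A / 4) ^ (2 * l))
    (hyg' : evenMoment lam e l (y - g') ≤ (2 * A / 4) ^ (2 * l)) :
    ∑ i, lam i * (truncPow p (2 * A) (inner ℝ g (e i))
      - truncPow p (4 * A) (inner ℝ g' (e i))) ^ 2 ≤ 200 * A ^ p := by
  have hn : 0 < n := by
    have : 0 < M ^ p := by positivity
    linarith
  set Q := (M ^ (p - 1)) ^ 2 * A ^ 2 with hQ
  have hQ0 : 0 ≤ Q := by positivity
  have h16 : Q * (2 / 16 ^ l) ≤ A ^ p := by
    have e1 : A ^ 2 = A ^ p * A ^ (2 - p) := by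
      rw [← Real.rpow_add hA, add_sub_cancel, Real.rpow_two]
    have h1 : A ^ (2 - p) ≤ 2 * M ^ (2 - p) := by
      calc A ^ (2 - p) ≤ (2 * M) ^ (2 - p) := Real.rpow_le_rpow hA.le hAM (by linarith)
        _ = 2 ^ (2 - p) * M ^ (2 - p) := Real.mul_rpow (by norm_num) hM.le
        _ ≤ _ := by
          gcongr
          have := Real.rpow_le_rpow_of_exponent_le (by norm_num : (1 : ℝ) ≤ 2)
            (by linarith : 2 - p ≤ 1)
          rwa [Real.rpow_one] at this
    have e2 : (M ^ (p - 1)) ^ 2 * M ^ (2 - p) = 2 * n := by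
      rw [← hMn, ← Real.rpow_natCast, ← Real.rpow_mul hM.le, ← Real.rpow_add hM]
      congr 1; push_cast; ring
    have h2 : Q ≤ 4 * n * A ^ p := by
      calc Q = A ^ p * ((M ^ (p - 1)) ^ 2 * A ^ (2 - p)) := by rw [hQ, e1]; ring
        _ ≤ A ^ p * ((M ^ (p - 1)) ^ 2 * (2 * M ^ (2 - p))) := by gcongr
        _ = A ^ p * (2 * ((M ^ (p - 1)) ^ 2 * M ^ (2 - p))) := by ring
        _ = _ := by rw [e2]; ring
    have h3 : 8 * n ≤ 16 ^ l := by
      have e3 : (16 : ℝ) ^ l = 2 ^ l * 8 ^ l := by rw [← mul_pow]; norm_num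
      have h4 : (8 : ℝ) ≤ 8 ^ l := le_self_pow₀ (by norm_num) (by omega)
      rw [e3]
      nlinarith [pow_pos (two_pos : (0 : ℝ) < 2) l]
    rw [mul_div_assoc', div_le_iff₀ (by positivity)]
    have h5 : 0 ≤ A ^ p := by positivity
    nlinarith
  calc _ ≤ ∑ i, (100 * A ^ p * (lam i * |inner ℝ y (e i)| ^ p)
          + 100 * Q * (1 / A ^ (2 * l) * (lam i * inner ℝ (y - g) (e i) ^ (2 * l))
            + 1 / (2 * A) ^ (2 * l) * (lam i * inner ℝ (y - g') (e i) ^ (2 * l)))) := by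
        refine Finset.sum_le_sum fun i _ => ?_
        have h := sq_truncPow_sub_truncPow_le (f := inner ℝ y (e i)) hp hp2 hA
          ((abs_inner_le_norm_of_norm_le_one (he i) g).trans hg)
          ((abs_inner_le_norm_of_norm_le_one (he i) g').trans hg') (by omega : 1 ≤ l)
        refine (mul_le_mul_of_nonneg_left h (hlam i)).trans (le_of_eq ?_)
        rw [← inner_sub_left, ← inner_sub_left, div_pow, div_pow, ← hQ]
        ring
    _ = 100 * A ^ p * (∑ i, lam i * |inner ℝ y (e i)| ^ p)
          + 100 * Q * (1 / A ^ (2 * l) * evenMoment lam e l (y - g)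
            + 1 / (2 * A) ^ (2 * l) * evenMoment lam e l (y - g')) := by
        unfold evenMoment
        simp only [Finset.sum_add_distrib, ← Finset.mul_sum]
    _ ≤ 100 * A ^ p * 1 + 100 * Q * (1 / A ^ (2 * l) * (A / 4) ^ (2 * l)
            + 1 / (2 * A) ^ (2 * l) * (2 * A / 4) ^ (2 * l)) := by
        gcongr
        exact hy
    _ = 100 * A ^ p + 100 * (Q * (2 / 16 ^ l)) := by
        have e4 : (4 : ℝ) ^ (2 * l) = 16 ^ l := by rw [pow_mul]; norm_num
        rw [div_pow, div_pow, e4]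
        field_simp
        ring
    _ ≤ _ := by linarith

end Chaining

section Signs

/-- Markov's inequality for a finite family of weights. -/
theorem card_filter_lt_le_of_sum_le {N : ℕ} {v : Fin N → ℝ} (hv : ∀ i, 0 ≤ v i) {W : ℝ}
    (hW : ∑ i, v i ≤ W) :
    ((Finset.univ.filter fun i => 4 * W / N < v i).card : ℝ) ≤ N / 4 := by
  rcases Nat.eq_zero_or_pos N with rfl | hN
  · simp
  have hN' : (0 : ℝ) < N := by exact_mod_cast hN
  have hW0 : 0 ≤ W := (Finset.sum_nonneg fun i _ => hv i).trans hW
  rcases hW0.eq_or_lt with rfl | hWp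
  · have h0 : ∀ i, v i = 0 := fun i =>
      le_antisymm ((Finset.single_le_sum (fun i _ => hv i) (Finset.mem_univ i)).trans hW) (hv i)
    simp only [h0, mul_zero, zero_div, lt_irrefl, Finset.filter_false, Finset.card_empty, Nat.cast_zero]
    positivity
  have h1 : ((Finset.univ.filter fun i => 4 * W / N < v i).card : ℝ) * (4 * W / N) ≤ W := by
    calc _ = ∑ i ∈ Finset.univ.filter (fun i => 4 * W / N < v i), 4 * W / N := by simp
      _ ≤ ∑ i ∈ Finset.univ.filter (fun i => 4 * W / N < v i), v i :=
        Finset.sum_le_sum fun i hi => (Finset.mem_filter.1 hi).2.le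
      _ ≤ ∑ i, v i := Finset.sum_le_sum_of_subset_of_nonneg (Finset.filter_subset _ _)
        fun i _ _ => hv i
      _ ≤ W := hW
  rw [mul_div_assoc', div_le_iff₀ hN'] at h1
  have h2 : W * (4 * ((Finset.univ.filter fun i => 4 * W / N < v i).card : ℝ)) ≤ W * N := by
    linarith
  have := le_of_mul_le_mul_left h2 hWp
  linarith

/-- Partial signs, vanishing on few coordinates, that balance a family of vectors. -/
theorem exists_partial_signs {N : ℕ} (hN : 0 < N) {lam w : Fin N → ℝ} (hlam : ∀ i, 0 ≤ lam i)
    (hsum : ∑ i, lam i ≤ 1) (hw : ∀ i, 0 ≤ w i) {κ : Type*} [Fintype κ] (a : κ → Fin N → ℝ)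
    (τ : κ → ℝ) (hτ : ∀ k, 0 ≤ τ k) (hexp : ∑ k, 2 * Real.exp (-τ k ^ 2 / 2) ≤ 3 / 4) :
    ∃ x : Fin N → ℝ, (∀ i, x i = 1 ∨ x i = -1 ∨ x i = 0) ∧
      ((Finset.univ.filter fun i => x i = 0).card : ℝ) ≤ N / 2 ∧
      |∑ i, x i| ≤ 5 / 2 * √N ∧
      |∑ i, x i * w i| ≤ 5 * √(1 / N) * ∑ i, w i ∧
      ∀ k, |∑ i, x i * (lam i * a k i)| ≤ τ k * √(4 / N * ∑ i, lam i * a k i ^ 2) := by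
  classical
  have hN' : (0 : ℝ) < N := by exact_mod_cast hN
  set W := ∑ i, w i with hW
  have hW0 : 0 ≤ W := Finset.sum_nonneg fun i _ => hw i
  let light : Fin N → Prop := fun i => lam i ≤ 4 * 1 / N ∧ w i ≤ 4 * W / N
  let z : Fin N → ℝ := fun i => if light i then 1 else 0
  have hz : ∀ i, z i ^ 2 = z i := fun i => by
    simp only [z]; split_ifs <;> simp
  have hz0 : ∀ i, 0 ≤ z i := fun i => by
    simp only [z]; split_ifs <;> simp
  have hz1 : ∀ i, z i ≤ 1 := fun i => by
    simp only [z]; split_ifs <;> simp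
  have hzlam : ∀ i, z i * lam i ≤ 4 / N := fun i => by
    simp only [z]
    split_ifs with h
    · have := h.1; rwa [one_mul, ← mul_one 4]
    · rw [zero_mul]; positivity
  have hzw : ∀ i, z i * w i ≤ 4 * W / N := fun i => by
    simp only [z]
    split_ifs with h
    · rw [one_mul]; exact h.2
    · rw [zero_mul]; positivity
  let a' : κ ⊕ Bool → Fin N → ℝ := Sum.elim (fun k i => z i * (lam i * a k i))
    (fun c i => z i * (if c then w i else 1))
  obtain ⟨ε, hε, hεb⟩ := exists_signs_forall_abs_sum_le a' (Sum.elim τ fun _ => √6)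
    (by rintro (k | c)
        · exact hτ k
        · exact Real.sqrt_nonneg 6)
    (by
      rw [Fintype.sum_sum_type]
      simp only [Sum.elim_inl, Sum.elim_inr, Fintype.sum_bool]
      rw [Real.sq_sqrt (by norm_num)]
      have h3 : Real.exp (-6 / 2) < 1 / 16 := by
        have e1 : (-6 / 2 : ℝ) = -3 := by norm_num
        rw [e1, Real.exp_neg, inv_lt_comm₀ (Real.exp_pos _) (by norm_num)]
        have e2 : Real.exp (3 : ℝ) = Real.exp 1 ^ 3 := by
          rw [← Real.exp_nat_mul]; norm_num
        rw [e2]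
        have := Real.exp_one_gt_d9
        calc ((1 / 16 : ℝ))⁻¹ < 2.7 ^ 3 := by norm_num
          _ ≤ _ := by gcongr; linarith
      linarith)
  have hcomm : ∀ (i : Fin N) (r : ℝ), ε i * z i * r = ε i * (z i * r) := fun i r => mul_assoc _ _ _
  refine ⟨fun i => ε i * z i, fun i => ?_, ?_, ?_, ?_, fun k => ?_⟩
  · simp only [z]
    rcases hε i with h | h <;> rw [h] <;> split_ifs <;> simp
  · have hsub : (Finset.univ.filter fun i => ε i * z i = 0) ⊆
        (Finset.univ.filter fun i => 4 * 1 / N < lam i) ∪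
        (Finset.univ.filter fun i => 4 * W / N < w i) := by
      intro i hi
      have hi' := (Finset.mem_filter.1 hi).2
      by_contra hcon
      simp only [Finset.mem_union, Finset.mem_filter, Finset.mem_univ, true_and, not_or,
        not_lt] at hcon
      have : z i = 1 := if_pos hcon
      rw [this, mul_one] at hi'
      rcases hε i with h | h <;> rw [h] at hi' <;> norm_num at hi'
    have h1 := (Finset.card_le_card hsub).trans (Finset.card_union_le _ _)
    have h2 := card_filter_lt_le_of_sum_le hlam hsum
    have h3 := card_filter_lt_le_of_sum_le hw hW.symm.le
    have h4 : ((Finset.univ.filter fun i => ε i * z i = 0).card : ℝ) ≤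
        ((Finset.univ.filter fun i => 4 * 1 / N < lam i).card : ℝ) +
        ((Finset.univ.filter fun i => 4 * W / N < w i).card : ℝ) := by exact_mod_cast h1
    linarith
  · have h := hεb (Sum.inr false)
    simp only [a', Sum.elim_inr, Bool.false_eq_true, if_false, mul_one] at h
    refine h.trans ?_
    have h1 : ∑ i, z i ^ 2 ≤ N := by
      calc _ ≤ ∑ _i : Fin N, (1 : ℝ) := Finset.sum_le_sum fun i _ => (hz i).le.trans (hz1 i)
        _ = _ := by simp
    have h6 : √6 ≤ (5 / 2 : ℝ) := Real.sqrt_le_iff.2 ⟨by norm_num, by norm_num⟩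
    gcongr
  · have h := hεb (Sum.inr true)
    simp only [a', Sum.elim_inr, if_true] at h
    simp only [hcomm]
    refine h.trans ?_
    have h1 : ∑ i, (z i * w i) ^ 2 ≤ 4 * W / N * W := by
      calc _ ≤ ∑ i, 4 * W / N * w i := Finset.sum_le_sum fun i _ => by
            rw [sq]
            exact mul_le_mul (hzw i) (mul_le_of_le_one_left (hw i) (hz1 i))
              (mul_nonneg (hz0 i) (hw i)) (by positivity)
        _ = _ := by rw [← Finset.mul_sum]
    calc √6 * √(∑ i, (z i * w i) ^ 2) ≤ √6 * √(4 * W / N * W) := by gcongr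
      _ = √(24 * (1 / N) * W ^ 2) := by
          rw [← Real.sqrt_mul (by norm_num)]; congr 1; ring
      _ = √24 * √(1 / N) * W := by
          rw [Real.sqrt_mul (by positivity), Real.sqrt_mul (by norm_num), Real.sqrt_sq hW0]
      _ ≤ _ := by
          have h6 : √24 ≤ (5 : ℝ) := Real.sqrt_le_iff.2 ⟨by norm_num, by norm_num⟩
          gcongr
  · have h := hεb (Sum.inl k)
    simp only [a', Sum.elim_inl] at h
    simp only [hcomm]
    refine h.trans (mul_le_mul_of_nonneg_left (Real.sqrt_le_sqrt ?_) (hτ k))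
    rw [Finset.mul_sum]
    refine Finset.sum_le_sum fun i _ => ?_
    have e1 : (z i * (lam i * a k i)) ^ 2 = (z i * lam i) * (lam i * a k i ^ 2) := by
      calc _ = z i ^ 2 * lam i ^ 2 * a k i ^ 2 := by ring
        _ = _ := by rw [hz]; ring
    rw [e1]
    exact mul_le_mul_of_nonneg_right (hzlam i) (mul_nonneg (hlam i) (sq_nonneg _))

end Signs

section Selection

variable {V : Type*} [NormedAddCommGroup V] [InnerProductSpace ℝ V] [FiniteDimensional ℝ V]

/-- The entropy bound for the net at scale `2⁻ʲ`. -/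
noncomputable def netEntropy (p n : ℝ) (l j : ℕ) : ℝ :=
  if j < l then 7000 * l * ((2 : ℝ) ^ p) ^ j else n * (j + 2)

theorem exists_nets {ι : Type*} [Fintype ι] {lam : ι → ℝ} {e : ι → V} (hlam : ∀ i, 0 ≤ lam i)
    (hsum : ∑ i, lam i ≤ 1) (he : ∀ i, ‖e i‖ ≤ 1)
    {p : ℝ} (hp : 1 ≤ p) (hp2 : p ≤ 2) {n M : ℝ} (hn : 0 < n)
    (hM : 0 < M) (hMn : M ^ p = 2 * n)
    (hE : ∀ y, ‖y‖ ^ 2 ≤ 2 * n * ∑ i, lam i * inner ℝ y (e i) ^ 2) {l : ℕ} (hl : 2 ≤ l)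
    (hnl : n ≤ 2 ^ l) (hV : (Module.finrank ℝ V : ℝ) ≤ n) (j : ℕ) :
    ∃ G : Finset V, ↑G ⊆ coordBall lam e p ∧ (G.card : ℝ) ≤ Real.exp (netEntropy p n l j) ∧
      ∀ y ∈ coordBall lam e p, ∃ g ∈ G, evenMoment lam e l (y - g) ≤ (M / 2 ^ j) ^ (2 * l) ∧
        (l ≤ j → ‖y - g‖ ≤ M / 2 ^ j) := by
  by_cases hj : j < l
  · obtain ⟨G, h1, h2, h3⟩ := exists_net_sudakov hlam hsum he hp hp2 hn hM hMn hE hl hnl j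
    refine ⟨G, h1, by rwa [netEntropy, if_pos hj], fun y hy => ?_⟩
    obtain ⟨g, hg, hyg⟩ := h3 y hy
    exact ⟨g, hg, hyg, fun h => absurd hj (not_lt.2 h)⟩
  · obtain ⟨G, h1, h2, h3⟩ := exists_net_volume hlam he hp hp2 hn hM hMn hE hV j
    refine ⟨G, h1, by rwa [netEntropy, if_neg hj], fun y hy => ?_⟩
    obtain ⟨g, hg, hyg⟩ := h3 y hy
    exact ⟨g, hg, (evenMoment_le_norm_pow hlam hsum he l _).trans
      (pow_le_pow_left₀ (norm_nonneg _) hyg _), fun _ => hyg⟩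

/-- The relative size of the link of the chain at scale `2⁻ʲ`. -/
noncomputable def linkSize (l j : ℕ) : ℝ := if j < l then 1 else (3 / 4) ^ (j + 1 - l)

theorem sum_linkSize_le (l k : ℕ) : ∑ j ∈ Finset.range (l + k), linkSize l j ≤ l + 3 := by
  rw [Finset.sum_range_add]
  have h1 : ∑ j ∈ Finset.range l, linkSize l j = l := by
    calc _ = ∑ _j ∈ Finset.range l, (1 : ℝ) := Finset.sum_congr rfl fun j hj => by
          rw [linkSize, if_pos (Finset.mem_range.1 hj)]
      _ = l := by simp
  have h2 : ∑ j ∈ Finset.range k, linkSize l (l + j) ≤ 3 := by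
    have e1 : ∀ j, linkSize l (l + j) = 3 / 4 * (3 / 4) ^ j := fun j => by
      rw [linkSize, if_neg (by omega), ← pow_succ']
      congr 1; omega
    simp only [e1]
    rw [← Finset.mul_sum]
    have := geom_sum_eq (by norm_num : (3 / 4 : ℝ) ≠ 1) k
    rw [this]
    have h3 : (0 : ℝ) ≤ (3 / 4) ^ k := by positivity
    have e2 : 3 / 4 * (((3 / 4 : ℝ) ^ k - 1) / (3 / 4 - 1)) = 3 - 3 * (3 / 4) ^ k := by
      norm_num; ring
    linarith
  linarith

theorem netEntropy_nonneg (p : ℝ) {n : ℝ} (hn : 0 ≤ n) (l j : ℕ) : 0 ≤ netEntropy p n l j := by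
  unfold netEntropy; split_ifs <;> positivity

theorem netEntropy_add_le {p n : ℝ} (hp : 1 ≤ p) (hn : 1 ≤ n) {l : ℕ} (hl : 2 ≤ l)
    (hnl : n ≤ 2 ^ l) (j : ℕ) :
    netEntropy p n l j + netEntropy p n l (j + 1) + (j + 3) ≤
      11000 * l * ((2 : ℝ) ^ p) ^ (j + 1) * linkSize l j ^ 2 := by
  set q : ℝ := 2 ^ p with hq
  have h2q : (2 : ℝ) ≤ q := by
    simpa using Real.rpow_le_rpow_of_exponent_le (by norm_num : (1 : ℝ) ≤ 2) hp
  have hl' : (2 : ℝ) ≤ l := by exact_mod_cast hl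
  have hqj : ∀ k, (2 : ℝ) ^ k ≤ q ^ k := fun k => pow_le_pow_left₀ (by norm_num) h2q k
  rcases lt_or_ge j l with hj | hj
  · rw [linkSize, if_pos hj, one_pow, mul_one]
    have hjl : (j : ℝ) + 1 ≤ l := by exact_mod_cast hj
    have hq0 : 0 < q ^ j := by positivity
    have h1 : netEntropy p n l j = 7000 * l * q ^ j := by rw [netEntropy, if_pos hj]
    have h2 : netEntropy p n l (j + 1) ≤ 7000 * l * q ^ (j + 1) := by
      rw [netEntropy]
      split_ifs with h
      · exact le_rfl
      · have e : j + 1 = l := by omega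
        have e' : ((j + 1 : ℕ) : ℝ) = l := by rw [e]
        rw [e', e]
        have := hqj l
        have h3 : n * (l + 2) ≤ q ^ l * (2 * l) := by
          gcongr
          · linarith
          · linarith
        have h4 : 0 ≤ q ^ l * l := by positivity
        nlinarith
    have h3 : (1 : ℝ) ≤ q ^ j := one_le_pow₀ (by linarith)
    rw [h1, pow_succ] at *
    have h4 : q ^ j * 2 ≤ q ^ j * q := by gcongr
    have h5 : l * (q ^ j * 2) ≤ l * (q ^ j * q) := by gcongr
    have h6 : (l : ℝ) * 1 ≤ l * q ^ j := by gcongr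
    nlinarith
  · obtain ⟨i, rfl⟩ := Nat.exists_eq_add_of_le hj
    rw [netEntropy, if_neg (by omega), netEntropy, if_neg (by omega), linkSize, if_neg (by omega)]
    have e1 : l + i + 1 - l = i + 1 := by omega
    rw [e1]
    push_cast
    have h1 : (2 : ℝ) ^ l * 2 ^ (i + 1) ≤ q ^ (l + i + 1) := by
      rw [← pow_add]; exact hqj _
    have h2 : ((i : ℝ) + 4) ≤ 8 * (9 / 8) ^ (i + 1) := by
      have := one_add_mul_le_pow (by norm_num : (-2 : ℝ) ≤ 1 / 8) (i + 1)
      norm_num at this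
      linarith
    have h3 : ((3 / 4 : ℝ) ^ (i + 1)) ^ 2 * 2 ^ (i + 1) = (9 / 8) ^ (i + 1) := by
      rw [← pow_mul, mul_comm (i + 1) 2, pow_mul, ← mul_pow]; norm_num
    have hi : (0 : ℝ) ≤ i := Nat.cast_nonneg i
    calc _ ≤ 3 * n * (l + i + 3) := by nlinarith
      _ ≤ 3 * 2 ^ l * (l * (i + 4)) := by
        gcongr
        nlinarith
      _ ≤ 3 * 2 ^ l * (l * (8 * (9 / 8) ^ (i + 1))) := by gcongr
      _ = 24 * l * (2 ^ l * 2 ^ (i + 1)) * ((3 / 4 : ℝ) ^ (i + 1)) ^ 2 := by rw [← h3]; ring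
      _ ≤ _ := by gcongr; norm_num

end Selection

section Chaining

theorem sum_two_mul_exp_neg_le (J : ℕ) :
    ∑ j ∈ Finset.range J, 2 * Real.exp (-((j : ℝ) + 3)) ≤ 3 / 4 := by
  have h1 : ∀ j : ℕ, 2 * Real.exp (-((j : ℝ) + 3)) ≤ 1 / 4 * (1 / 2) ^ j := fun j => by
    have h2 : Real.exp (-1) ≤ 1 / 2 := by
      rw [Real.exp_neg, one_div]
      exact inv_anti₀ (by norm_num) (by linarith [Real.add_one_le_exp (1 : ℝ)])
    have h3 : Real.exp (-((j : ℝ) + 3)) = Real.exp (-1) ^ (j + 3) := by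
      rw [← Real.exp_nat_mul]; push_cast; ring_nf
    rw [h3]
    calc 2 * Real.exp (-1) ^ (j + 3) ≤ 2 * (1 / 2) ^ (j + 3) := by
          gcongr
      _ = _ := by rw [pow_add]; ring
  refine (Finset.sum_le_sum fun j _ => h1 j).trans ?_
  rw [← Finset.mul_sum]
  have e1 := geom_sum_eq (by norm_num : (1 / 2 : ℝ) ≠ 1) J
  have e2 : 1 / 4 * (((1 / 2 : ℝ) ^ J - 1) / (1 / 2 - 1)) = 1 / 2 - 1 / 2 * (1 / 2) ^ J := by
    norm_num; ring
  have h3 : (0 : ℝ) ≤ (1 / 2) ^ J := by positivity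
  rw [e1, e2]
  linarith

variable {V : Type*} [NormedAddCommGroup V] [InnerProductSpace ℝ V] [FiniteDimensional ℝ V]

/-- Partial signs that balance the functionals `|⟪y, e i⟫| ^ p` uniformly over `coordBall`. -/
theorem exists_partial_signs_coordBall {N : ℕ} (hN : 0 < N) {lam w : Fin N → ℝ} {e : Fin N → V}
    (hlam : ∀ i, 0 ≤ lam i) (hsum : ∑ i, lam i ≤ 1) (hw : ∀ i, 0 ≤ w i) (he : ∀ i, ‖e i‖ ≤ 1)
    {p : ℝ} (hp : 1 ≤ p) (hp2 : p ≤ 2) {n : ℝ} (hn : 1 ≤ n)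
    (hE : ∀ y, ‖y‖ ^ 2 ≤ 2 * n * ∑ i, lam i * inner ℝ y (e i) ^ 2) {l : ℕ} (hl : 2 ≤ l)
    (hnl : n ≤ 2 ^ l) (hV : (Module.finrank ℝ V : ℝ) ≤ n) :
    ∃ x : Fin N → ℝ, (∀ i, x i = 1 ∨ x i = -1 ∨ x i = 0) ∧
      ((Finset.univ.filter fun i => x i = 0).card : ℝ) ≤ N / 2 ∧
      |∑ i, x i| ≤ 5 / 2 * √N ∧
      |∑ i, x i * w i| ≤ 5 * √(1 / N) * ∑ i, w i ∧
      ∀ y ∈ coordBall lam e p,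
        |∑ i, x i * (lam i * |inner ℝ y (e i)| ^ p)| ≤ 24000 * √(l * n / N) * (l + 3) + 1 / N := by
  have hN' : (0 : ℝ) < N := by exact_mod_cast hN
  have hn0 : 0 < n := by linarith
  have hp0 : 0 < p := by linarith
  obtain ⟨M, hM, hMn⟩ : ∃ M : ℝ, 0 < M ∧ M ^ p = 2 * n :=
    ⟨(2 * n) ^ p⁻¹, by positivity, Real.rpow_inv_rpow (by positivity) hp0.ne'⟩
  obtain ⟨k, hk⟩ : ∃ k : ℕ, 36 * n * N < 2 ^ k := pow_unbounded_of_one_lt _ (by norm_num)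
  choose G hGsub hGcard hG using
    exists_nets hlam hsum he hp hp2 hn0 hM hMn hE hl hnl hV
  let Φ : ℕ → V → Fin N → ℝ := fun j g i => truncPow p (8 * M / 2 ^ j) (inner ℝ g (e i))
  let S : ℕ → ℝ := fun j => netEntropy p n l j + netEntropy p n l (j + 1) + (j + 3)
  have hS0 : ∀ j, 0 ≤ S j := fun j => by
    have h1 := netEntropy_nonneg p hn0.le l j
    have h2 := netEntropy_nonneg p hn0.le l (j + 1)
    positivity
  obtain ⟨x, hx, hx0, hx1, hxw, hxa⟩ := exists_partial_signs hN hlam hsum hw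
    (κ := Σ j : Fin (l + k), ↥(G j) × ↥(G (j + 1)))
    (fun c i => Φ (c.1 + 1) c.2.2 i - Φ c.1 c.2.1 i) (fun c => √(2 * S c.1))
    (fun c => Real.sqrt_nonneg _) (by
      rw [Fintype.sum_sigma]
      refine le_trans ?_ (sum_two_mul_exp_neg_le (l + k))
      rw [← Fin.sum_univ_eq_sum_range (fun j => 2 * Real.exp (-((j : ℝ) + 3)))]
      refine Finset.sum_le_sum fun j _ => ?_
      dsimp only
      rw [Real.sq_sqrt (mul_nonneg (by norm_num) (hS0 _)), Finset.sum_const, Finset.card_univ,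
        Fintype.card_prod, Fintype.card_coe, Fintype.card_coe, nsmul_eq_mul]
      push_cast
      calc ((G j).card : ℝ) * (G (j + 1)).card * (2 * Real.exp (-(2 * S j) / 2))
          ≤ Real.exp (netEntropy p n l j) * Real.exp (netEntropy p n l (j + 1)) *
            (2 * Real.exp (-(2 * S j) / 2)) := by
              gcongr
              · exact hGcard _
              · exact hGcard _
        _ = 2 * Real.exp (-((j : ℝ) + 3)) := by
            rw [← Real.exp_add, mul_left_comm, ← Real.exp_add]
            congr 2
            simp only [S]; ring)
  refine ⟨x, hx, hx0, hx1, hxw, fun y hy => ?_⟩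
  choose g hgG hgm hgn using fun j => hG j y hy
  have hgM : ∀ j, ‖g j‖ ≤ M := fun j =>
    norm_le_of_mem_coordBall hlam he hp hp2 hn0 hM hMn hE (hGsub j (hgG j))
  have hyM : ‖y‖ ≤ M := norm_le_of_mem_coordBall hlam he hp hp2 hn0 hM hMn hE hy
  have hlink : ∀ j ∈ Finset.range (l + k),
      |∑ i, x i * (lam i * (Φ (j + 1) (g (j + 1)) i - Φ j (g j) i))| ≤
        24000 * √(l * n / N) * linkSize l j := fun j hj => by
    have hls : 0 ≤ linkSize l j := by unfold linkSize; split_ifs <;> positivity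
    set A : ℝ := 4 * M / 2 ^ (j + 1) with hA
    have hA0 : 0 < A := by positivity
    have h1 := hxa ⟨⟨j, Finset.mem_range.1 hj⟩, ⟨g j, hgG j⟩, ⟨g (j + 1), hgG (j + 1)⟩⟩
    have h2 := sum_sq_link_le hlam he hp hp2 hM hMn hl hnl hA0
      (by
        rw [hA, div_le_iff₀ (by positivity), pow_succ]
        have := one_le_pow₀ (by norm_num : (1 : ℝ) ≤ 2) (n := j)
        nlinarith) hy (hgM (j + 1)) (hgM j)
      (by
        have : A / 4 = M / 2 ^ (j + 1) := by rw [hA]; ring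
        rw [this]; exact hgm _)
      (by
        have : 2 * A / 4 = M / 2 ^ j := by rw [hA, pow_succ]; field_simp
        rw [this]; exact hgm _)
    have e1 : 2 * A = 8 * M / 2 ^ (j + 1) := by rw [hA]; ring
    have e2 : 4 * A = 8 * M / 2 ^ j := by rw [hA, pow_succ]; field_simp; norm_num
    rw [e1, e2] at h2
    refine h1.trans ?_
    have hAp : A ^ p ≤ 32 * n / ((2 : ℝ) ^ p) ^ (j + 1) := by
      rw [hA, Real.div_rpow (by positivity) (by positivity), Real.mul_rpow (by norm_num) hM.le,
        hMn, ← Real.rpow_natCast_mul (by norm_num), mul_comm ((j + 1 : ℕ) : ℝ) p,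
        Real.rpow_mul_natCast (by norm_num)]
      have h4 : (4 : ℝ) ^ p ≤ 4 ^ (2 : ℝ) :=
        Real.rpow_le_rpow_of_exponent_le (by norm_num) hp2
      norm_num at h4
      refine div_le_div_of_nonneg_right ?_ (by positivity)
      nlinarith
    have hSj := netEntropy_add_le hp hn hl hnl j
    rw [← Real.sqrt_mul (mul_nonneg (by norm_num) (hS0 _))]
    refine Real.sqrt_le_iff.2 ⟨by positivity, ?_⟩
    have hq : (0 : ℝ) < ((2 : ℝ) ^ p) ^ (j + 1) := by positivity
    calc 2 * S j * (4 / N * ∑ i, lam i * (Φ (j + 1) (g (j + 1)) i - Φ j (g j) i) ^ 2)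
        ≤ 2 * (11000 * l * ((2 : ℝ) ^ p) ^ (j + 1) * linkSize l j ^ 2) *
          (4 / N * (200 * (32 * n / ((2 : ℝ) ^ p) ^ (j + 1)))) := by
          have h5 : ∑ i, lam i * (Φ (j + 1) (g (j + 1)) i - Φ j (g j) i) ^ 2 ≤
            200 * (32 * n / ((2 : ℝ) ^ p) ^ (j + 1)) := h2.trans (by gcongr)
          have h6 : 0 ≤ ∑ i, lam i * (Φ (j + 1) (g (j + 1)) i - Φ j (g j) i) ^ 2 :=
            Finset.sum_nonneg fun i _ => mul_nonneg (hlam i) (sq_nonneg _)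
          gcongr
      _ = 563200000 * (l * n / N) * linkSize l j ^ 2 := by field_simp; ring
      _ ≤ 576000000 * (l * n / N) * linkSize l j ^ 2 := by gcongr; norm_num
      _ = _ := by
          rw [mul_pow, mul_pow, Real.sq_sqrt (by positivity)]; norm_num
  have hbot : |∑ i, x i * (lam i * (|inner ℝ y (e i)| ^ p - Φ (l + k) (g (l + k)) i))| ≤
      1 / N := by
    have hxabs : ∀ i, |x i| ≤ 1 := fun i => by
      rcases hx i with h | h | h <;> rw [h] <;> norm_num
    have h1 : ∀ i, |(|inner ℝ y (e i)| ^ p - Φ (l + k) (g (l + k)) i)| ≤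
        36 * n / 2 ^ (l + k) := fun i => by
      have h2 := abs_rpow_sub_truncPow_le hp hp2 (t := 8 * M / 2 ^ (l + k)) (by positivity)
        ((abs_inner_le_norm_of_norm_le_one (he i) y).trans hyM)
        ((abs_inner_le_norm_of_norm_le_one (he i) (g (l + k))).trans (hgM _))
      refine h2.trans ?_
      have h3 : |inner ℝ y (e i) - inner ℝ (g (l + k)) (e i)| ≤ M / 2 ^ (l + k) := by
        rw [← inner_sub_left]
        exact (abs_inner_le_norm_of_norm_le_one (he i) _).trans (hgn _ (Nat.le_add_right l k))
      have h4 : M ^ (p - 1) * M = 2 * n := by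
        rw [← Real.rpow_add_one hM.ne', sub_add_cancel, hMn]
      calc _ ≤ 2 * M ^ (p - 1) * (M / 2 ^ (l + k) + 8 * M / 2 ^ (l + k)) := by gcongr
        _ = 18 * (M ^ (p - 1) * M) / 2 ^ (l + k) := by ring
        _ = _ := by rw [h4]; ring
    have h5 : 36 * n / 2 ^ (l + k) ≤ 1 / N := by
      rw [div_le_div_iff₀ (by positivity) hN', one_mul]
      refine hk.le.trans (pow_le_pow_right₀ (by norm_num) (Nat.le_add_left k l))
    refine (Finset.abs_sum_le_sum_abs _ _).trans ?_
    calc _ ≤ ∑ i, lam i * (1 / N) := Finset.sum_le_sum fun i _ => by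
          rw [abs_mul, abs_mul, abs_of_nonneg (hlam i)]
          exact (mul_le_of_le_one_left (mul_nonneg (hlam i) (abs_nonneg _)) (hxabs i)).trans
            (mul_le_mul_of_nonneg_left ((h1 i).trans h5) (hlam i))
      _ = (∑ i, lam i) * (1 / N) := by rw [Finset.sum_mul]
      _ ≤ _ := mul_le_of_le_one_left (by positivity) hsum
  have htop : ∀ i, Φ 0 (g 0) i = 0 := fun i => by
    have h1 := (abs_inner_le_norm_of_norm_le_one (he i) (g 0)).trans (hgM 0)
    simp only [Φ, truncPow]
    rw [max_eq_right (by rw [pow_zero]; linarith), Real.zero_rpow hp0.ne']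
  have htel : ∀ i, |inner ℝ y (e i)| ^ p =
      (|inner ℝ y (e i)| ^ p - Φ (l + k) (g (l + k)) i) +
        ∑ j ∈ Finset.range (l + k), (Φ (j + 1) (g (j + 1)) i - Φ j (g j) i) := fun i => by
    rw [Finset.sum_range_sub (fun j => Φ j (g j) i), htop]; ring
  have hdec : ∑ i, x i * (lam i * |inner ℝ y (e i)| ^ p) =
      ∑ i, x i * (lam i * (|inner ℝ y (e i)| ^ p - Φ (l + k) (g (l + k)) i)) +
      ∑ j ∈ Finset.range (l + k),
        ∑ i, x i * (lam i * (Φ (j + 1) (g (j + 1)) i - Φ j (g j) i)) := by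
    rw [Finset.sum_comm, ← Finset.sum_add_distrib]
    refine Finset.sum_congr rfl fun i _ => ?_
    rw [← Finset.mul_sum, ← Finset.mul_sum, ← mul_add, ← mul_add, ← htel]
  rw [hdec, add_comm]
  refine (abs_add_le _ _).trans (add_le_add ?_ hbot)
  refine (Finset.abs_sum_le_sum_abs _ _).trans ((Finset.sum_le_sum hlink).trans ?_)
  rw [← Finset.mul_sum]
  gcongr
  exact sum_linkSize_le l k

end Chaining

section Balancing

theorem one_half_le_log_mul_sqrt_log {n : ℝ} (hn : 2 ≤ n) :
    1 / 2 ≤ Real.log n * √(Real.log n) := by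
  have h1 : 0.69 ≤ Real.log n :=
    (by linarith [Real.log_two_gt_d9] : (0.69 : ℝ) ≤ Real.log 2).trans
      (Real.log_le_log (by norm_num) hn)
  have h2 : 0.8 ≤ √(Real.log n) := Real.le_sqrt_of_sq_le (by norm_num; linarith)
  nlinarith

/-- Partial signs that balance a weight and all `p`-th powers of functions in a subspace of
dimension at most `n`. -/
theorem exists_balancing_partial_signs {n N : ℕ} (hn : 2 ≤ n) (hnN : n ≤ N) {p : ℝ} (hp : 1 ≤ p)
    (hp2 : p ≤ 2) (E : Submodule ℝ (Fin N → ℝ)) (hE : Module.finrank ℝ E ≤ n) {w : Fin N → ℝ}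
    (hw : ∀ i, 0 ≤ w i) {δ : ℝ} (hδ : 400000 * (√(n / N) * (Real.log n * √(Real.log n))) ≤ δ) :
    ∃ x : Fin N → ℝ, (∀ i, x i = 1 ∨ x i = -1 ∨ x i = 0) ∧
      ((Finset.univ.filter fun i => x i = 0).card : ℝ) ≤ N / 2 ∧
      |∑ i, x i| ≤ 5 / 2 * √N ∧
      |∑ i, x i * w i| ≤ δ * ∑ i, w i ∧
      ∀ f ∈ E, |∑ i, x i * |f i| ^ p| ≤ δ * ∑ i, |f i| ^ p := by
  have hN : 0 < N := by omega
  have hN' : (0 : ℝ) < N := by exact_mod_cast hN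
  have hn' : (2 : ℝ) ≤ n := by exact_mod_cast hn
  have hp0 : 0 < p := by linarith
  obtain ⟨lam, e, hlam, hsum, he, hLE, hrep⟩ := exists_lewis_density E hp hp2
  set m := Nat.log 2 n with hm
  have hm1 : 1 ≤ m := Nat.log_pos (by norm_num) hn
  have hm1' : (1 : ℝ) ≤ m := by exact_mod_cast hm1
  have hnl : (n : ℝ) ≤ 2 ^ (m + 1) := by
    exact_mod_cast (Nat.lt_pow_succ_log_self (by norm_num) n).le
  have hmlog : m * 0.69 ≤ Real.log n := by
    have h1 : (2 : ℝ) ^ m ≤ n := by exact_mod_cast Nat.pow_log_le_self 2 (by omega)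
    have h2 := Real.log_le_log (by positivity) h1
    rw [Real.log_pow] at h2
    have := Real.log_two_gt_d9
    nlinarith
  have hsq1 : √(1 / N) ≤ √((n : ℝ) / N) := by gcongr; linarith
  have hbase : 0 < √((n : ℝ) / N) := by positivity
  set P := √((n : ℝ) / N) * (Real.log n * √(Real.log n)) with hP
  have hPb : √((n : ℝ) / N) ≤ 2 * P := by
    have h1 := one_half_le_log_mul_sqrt_log hn'
    rw [hP]
    nlinarith
  obtain ⟨x, hx, hx0, hx1, hxw, hxf⟩ := exists_partial_signs_coordBall hN hlam hsum hw he hp hp2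
    (n := n) (l := m + 1) (by linarith)
    (fun y => (hLE y).trans (by
      have h1 : 0 ≤ ∑ i, lam i * inner ℝ y (e i) ^ 2 :=
        Finset.sum_nonneg fun i _ => mul_nonneg (hlam i) (sq_nonneg _)
      have h2 : (Module.finrank ℝ E : ℝ) ≤ n := by exact_mod_cast hE
      gcongr)) (by omega) hnl (by simpa using hE)
  refine ⟨x, hx, hx0, hx1, hxw.trans ?_, fun f hf => ?_⟩
  · have : 0 ≤ ∑ i, w i := Finset.sum_nonneg fun i _ => hw i
    gcongr
    linarith
  have hF0 : 0 ≤ ∑ i, |f i| ^ p := Finset.sum_nonneg fun i _ => by positivity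
  rcases hF0.eq_or_lt with hF | hF
  · have h0 := (Finset.sum_eq_zero_iff_of_nonneg fun i _ => by positivity).1 hF.symm
    rw [← hF, mul_zero, Finset.sum_eq_zero fun i hi => by rw [h0 i hi, mul_zero], abs_zero]
  obtain ⟨y, hy⟩ := hrep f hf
  set F := ∑ i, |f i| ^ p with hFdef
  set c := F⁻¹ ^ p⁻¹ with hc
  have hc0 : 0 ≤ c := by positivity
  have hcp : c ^ p = F⁻¹ := Real.rpow_inv_rpow (by positivity) hp0.ne'
  have hterm : ∀ i, lam i * |inner ℝ (c • y) (e i)| ^ p = F⁻¹ * |f i| ^ p := fun i => by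
    rw [real_inner_smul_left, abs_mul, abs_of_nonneg hc0, Real.mul_rpow hc0 (abs_nonneg _), hcp,
      hy i]
    ring
  have hmem : c • y ∈ coordBall lam e p := by
    change ∑ i, lam i * |inner ℝ (c • y) (e i)| ^ p ≤ 1
    simp only [hterm]
    rw [← Finset.mul_sum, ← hFdef, inv_mul_cancel₀ hF.ne']
  have h1 := hxf _ hmem
  simp only [hterm] at h1
  have e1 : ∑ i, x i * (F⁻¹ * |f i| ^ p) = F⁻¹ * ∑ i, x i * |f i| ^ p := by
    rw [Finset.mul_sum]
    exact Finset.sum_congr rfl fun i _ => by ring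
  rw [e1, abs_mul, abs_of_pos (inv_pos.2 hF), inv_mul_le_iff₀ hF] at h1
  rw [mul_comm δ]
  refine h1.trans (mul_le_mul_of_nonneg_left (le_trans ?_ hδ) hF.le)
  push_cast
  have h2 : √(((m : ℝ) + 1) * n / N) ≤ √((n : ℝ) / N) * (2 * √(Real.log n)) := by
    rw [mul_div_assoc, Real.sqrt_mul (by positivity), mul_comm]
    gcongr
    have e2 : 2 * √(Real.log n) = √(4 * Real.log n) := by
      rw [Real.sqrt_mul (by norm_num)]
      congr 1
      rw [show (4 : ℝ) = 2 ^ 2 by norm_num, Real.sqrt_sq (by norm_num)]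
    rw [e2]
    gcongr
    linarith
  have h3 : (m : ℝ) + 1 + 3 ≤ 8 * Real.log n := by linarith
  have h4 : 1 / (N : ℝ) ≤ √(1 / N) := by
    refine Real.le_sqrt_of_sq_le ?_
    have hN1 : 1 / (N : ℝ) ≤ 1 := by
      rw [div_le_one hN']; exact_mod_cast hN
    have : 0 ≤ 1 / (N : ℝ) := by positivity
    nlinarith
  calc _ ≤ 24000 * (√((n : ℝ) / N) * (2 * √(Real.log n))) * (8 * Real.log n) + 2 * P := by
        gcongr
        linarith
    _ = 384002 * P := by rw [hP]; ring
    _ ≤ _ := by nlinarith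

/-- A `[0, 1]`-valued weight, equal to `0` and to `1` on at least one eighth of the coordinates
each, that halves a given weight and all `p`-th powers of functions in a subspace. -/
theorem exists_halving_weight {n N : ℕ} (hn : 2 ≤ n) (hnN : n ≤ N) {p : ℝ} (hp : 1 ≤ p)
    (hp2 : p ≤ 2) (E : Submodule ℝ (Fin N → ℝ)) (hE : Module.finrank ℝ E ≤ n) {w : Fin N → ℝ}
    (hw : ∀ i, 0 ≤ w i) {δ : ℝ} (hδ : 400000 * (√(n / N) * (Real.log n * √(Real.log n))) ≤ δ) :
    ∃ v : Fin N → ℝ, (∀ i, 0 ≤ v i ∧ v i ≤ 1) ∧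
      ((Finset.univ.filter fun i => v i ≠ 0).card : ℝ) ≤ 7 * N / 8 ∧
      ((Finset.univ.filter fun i => 1 - v i ≠ 0).card : ℝ) ≤ 7 * N / 8 ∧
      (∑ i, v i * w i ≤ (1 + δ) / 2 * ∑ i, w i ∧
        ∑ i, (1 - v i) * w i ≤ (1 + δ) / 2 * ∑ i, w i) ∧
      ∀ f ∈ E, ∑ i, v i * |f i| ^ p ≤ (1 + δ) / 2 * ∑ i, |f i| ^ p ∧
        ∑ i, (1 - v i) * |f i| ^ p ≤ (1 + δ) / 2 * ∑ i, |f i| ^ p := by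
  classical
  have hN' : (2 : ℝ) ≤ N := by exact_mod_cast hn.trans hnN
  have hn' : (2 : ℝ) ≤ n := by exact_mod_cast hn
  rcases le_total 1 δ with hδ1 | hδ1
  · obtain ⟨S, -, hS⟩ := Finset.exists_subset_card_eq
      (s := (Finset.univ : Finset (Fin N))) (n := N / 2) (by simp; omega)
    let v : Fin N → ℝ := fun i => if i ∈ S then 1 else 0
    have hv : ∀ i, 0 ≤ v i ∧ v i ≤ 1 := fun i => by
      simp only [v]; split_ifs <;> norm_num
    have key : ∀ g : Fin N → ℝ, (∀ i, 0 ≤ g i) → ∑ i, v i * g i ≤ (1 + δ) / 2 * ∑ i, g i ∧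
        ∑ i, (1 - v i) * g i ≤ (1 + δ) / 2 * ∑ i, g i := fun g hg => by
      have h0 : ∑ i, g i ≤ (1 + δ) / 2 * ∑ i, g i :=
        le_mul_of_one_le_left (Finset.sum_nonneg fun i _ => hg i) (by linarith)
      exact ⟨(Finset.sum_le_sum fun i _ => mul_le_of_le_one_left (hg i) (hv i).2).trans h0,
        (Finset.sum_le_sum fun i _ => mul_le_of_le_one_left (hg i)
          (by linarith [(hv i).1])).trans h0⟩
    refine ⟨v, hv, ?_, ?_, key w hw, fun f _ => key _ fun i => by positivity⟩
    · have h1 : (Finset.univ.filter fun i => v i ≠ 0) = S := by ext i; simp [v]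
      have h2 : ((N / 2 : ℕ) : ℝ) ≤ N / 2 := Nat.cast_div_le
      rw [h1, hS]
      linarith
    · have h1 : (Finset.univ.filter fun i => 1 - v i ≠ 0) = Sᶜ := by
        ext i; simp only [v, Finset.mem_filter, Finset.mem_univ, true_and, Finset.mem_compl]
        split_ifs with h <;> simp [h]
      rw [h1, Finset.card_compl, hS, Fintype.card_fin]
      have h2 : 8 * (N - N / 2) ≤ 7 * N := by omega
      have h3 : (8 : ℝ) * (N - N / 2 : ℕ) ≤ 7 * N := by exact_mod_cast h2
      linarith
  · obtain ⟨x, hx, hx0, hx1, hxw, hxf⟩ := exists_balancing_partial_signs hn hnN hp hp2 E hE hw hδ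
    have hsum : ∀ (g : Fin N → ℝ), |∑ i, x i * g i| ≤ δ * ∑ i, g i →
        ∑ i, (1 + x i) / 2 * g i ≤ (1 + δ) / 2 * ∑ i, g i ∧
        ∑ i, (1 - (1 + x i) / 2) * g i ≤ (1 + δ) / 2 * ∑ i, g i := fun g hg => by
      have e1 : ∑ i, (1 + x i) / 2 * g i = (∑ i, g i + ∑ i, x i * g i) / 2 := by
        rw [← Finset.sum_add_distrib, Finset.sum_div]
        exact Finset.sum_congr rfl fun i _ => by ring
      have e2 : ∑ i, (1 - (1 + x i) / 2) * g i = (∑ i, g i - ∑ i, x i * g i) / 2 := by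
        rw [← Finset.sum_sub_distrib, Finset.sum_div]
        exact Finset.sum_congr rfl fun i _ => by ring
      rw [e1, e2]
      have := abs_le.1 hg
      constructor <;> linarith
    have hlarge : 10 ≤ √(N : ℝ) := by
      have h1 := one_half_le_log_mul_sqrt_log hn'
      have h2 : √(1 / (N : ℝ)) ≤ √((n : ℝ) / N) := by gcongr; linarith
      have h3 : √(1 / (N : ℝ)) * (1 / 2) ≤ √((n : ℝ) / N) * (Real.log n * √(Real.log n)) := by
        gcongr
      have h4 : √(1 / (N : ℝ)) ≤ 1 / 10 := by linarith
      rw [Real.sqrt_div zero_le_one, Real.sqrt_one] at h4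
      exact (one_div_le_one_div (by positivity) (by norm_num)).1 h4
    have hNsq : √(N : ℝ) * √N = N := Real.mul_self_sqrt (by positivity)
    have hx1' := abs_le.1 hx1
    have hcount : ∀ s : ℝ, s = 1 ∨ s = -1 →
        ((Finset.univ.filter fun i => x i ≠ s).card : ℝ) ≤ 7 * N / 8 := fun s hs => by
      have h1 : ∀ i, (if x i ≠ s then (1 : ℝ) else 0) =
          1 / 2 + 1 / 2 * (if x i = 0 then 1 else 0) - s / 2 * x i := fun i => by
        rcases hs with rfl | rfl <;> rcases hx i with h | h | h <;> rw [h] <;> norm_num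
      have h2 : ((Finset.univ.filter fun i => x i ≠ s).card : ℝ) =
          N / 2 + 1 / 2 * (Finset.univ.filter fun i => x i = 0).card - s / 2 * ∑ i, x i := by
        rw [Finset.card_filter, Finset.card_filter]
        push_cast
        rw [Finset.sum_congr rfl fun i _ => h1 i, Finset.sum_sub_distrib, Finset.sum_add_distrib,
          ← Finset.mul_sum, ← Finset.mul_sum]
        simp
        ring
      rw [h2]
      rcases hs with rfl | rfl <;> nlinarith
    refine ⟨fun i => (1 + x i) / 2, fun i => ?_, ?_, ?_, hsum w hxw, fun f hf => hsum _ (hxf f hf)⟩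
    · dsimp only; rcases hx i with h | h | h <;> rw [h] <;> norm_num
    · convert hcount (-1) (Or.inr rfl) using 4 with i
      constructor <;> intro h h' <;> apply h <;> linarith
    · convert hcount 1 (Or.inl rfl) using 4 with i
      constructor <;> intro h h' <;> apply h <;> linarith

end Balancing

section Factorization

theorem abs_apply_le_supNormFin {k : ℕ} (x : Fin k → ℝ) (i : Fin k) : |x i| ≤ supNormFin x :=
  le_csSup (Set.finite_range _).bddAbove ⟨i, rfl⟩

theorem supNormFin_nonneg {k : ℕ} (x : Fin k → ℝ) : 0 ≤ supNormFin x :=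
  Real.sSup_nonneg (by rintro _ ⟨i, rfl⟩; exact abs_nonneg _)

theorem supNormFin_le {k : ℕ} {x : Fin k → ℝ} {a : ℝ} (ha : 0 ≤ a) (h : ∀ i, |x i| ≤ a) :
    supNormFin x ≤ a :=
  Real.sSup_le (by rintro _ ⟨i, rfl⟩; exact h i) ha

theorem lqNormFin_nonneg (q : ℝ) {k : ℕ} (x : Fin k → ℝ) : 0 ≤ lqNormFin q x :=
  Real.rpow_nonneg (Finset.sum_nonneg fun _ _ => Real.rpow_nonneg (abs_nonneg _) _) _

theorem lqNormFin_le_one_iff {q : ℝ} (hq : 0 < q) {k : ℕ} {x : Fin k → ℝ} :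
    lqNormFin q x ≤ 1 ↔ ∑ i, |x i| ^ q ≤ 1 := by
  have h0 : 0 ≤ ∑ i, |x i| ^ q :=
    Finset.sum_nonneg fun _ _ => Real.rpow_nonneg (abs_nonneg _) _
  rw [lqNormFin, one_div]
  conv_lhs => rw [← Real.one_rpow q⁻¹]
  exact Real.rpow_le_rpow_iff h0 zero_le_one (inv_pos.2 hq)

theorem abs_apply_le_one_of_lqNormFin_le_one {q : ℝ} (hq : 0 < q) {k : ℕ} {x : Fin k → ℝ}
    (hx : lqNormFin q x ≤ 1) (i : Fin k) : |x i| ≤ 1 := by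
  rw [lqNormFin_le_one_iff hq] at hx
  have h1 : |x i| ^ q ≤ 1 :=
    (Finset.single_le_sum (f := fun i => |x i| ^ q)
      (fun i _ => Real.rpow_nonneg (abs_nonneg (x i)) q) (Finset.mem_univ i)).trans hx
  exact le_of_not_gt fun h => (Real.one_lt_rpow h hq).not_ge h1

variable {X Y : Type*} [NormedAddCommGroup X] [NormedSpace ℝ X] [NormedAddCommGroup Y]
  [NormedSpace ℝ Y]

theorem nuQ_bddBelow (q : ℝ) (k : ℕ) (v : X →ₗ[ℝ] Y) :
    BddBelow { r : ℝ | ∃ (A : X →ₗ[ℝ] (Fin k → ℝ)) (d : Fin k → ℝ) (B : (Fin k → ℝ) →ₗ[ℝ] Y),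
      v = B ∘ₗ (LinearMap.pi fun i => d i • LinearMap.proj i) ∘ₗ A ∧
      r = sSup {a | ∃ x : X, ‖x‖ ≤ 1 ∧ a = supNormFin (A x)} *
        sSup {a | ∃ x : Fin k → ℝ, supNormFin x ≤ 1 ∧ a = lqNormFin q fun i => d i * x i} *
        sSup {a | ∃ x : Fin k → ℝ, lqNormFin q x ≤ 1 ∧ a = ‖B x‖} } := by
  refine ⟨0, ?_⟩
  rintro _ ⟨A, d, B, -, rfl⟩
  refine mul_nonneg (mul_nonneg ?_ ?_) ?_ <;> refine Real.sSup_nonneg ?_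
  · rintro _ ⟨x, -, rfl⟩; exact supNormFin_nonneg _
  · rintro _ ⟨x, -, rfl⟩; exact lqNormFin_nonneg _ _
  · rintro _ ⟨x, -, rfl⟩; exact norm_nonneg _

theorem nuQ_nonneg (q : ℝ) (k : ℕ) (v : X →ₗ[ℝ] Y) : 0 ≤ nuQ q k v := by
  refine Real.sInf_nonneg ?_
  rintro _ ⟨A, d, B, -, rfl⟩
  refine mul_nonneg (mul_nonneg ?_ ?_) ?_ <;> refine Real.sSup_nonneg ?_
  · rintro _ ⟨x, -, rfl⟩; exact supNormFin_nonneg _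
  · rintro _ ⟨x, -, rfl⟩; exact lqNormFin_nonneg _ _
  · rintro _ ⟨x, -, rfl⟩; exact norm_nonneg _

theorem nuQ_le {q : ℝ} {k : ℕ} {v : X →ₗ[ℝ] Y} (A : X →ₗ[ℝ] (Fin k → ℝ)) (d : Fin k → ℝ)
    (B : (Fin k → ℝ) →ₗ[ℝ] Y)
    (hv : v = B ∘ₗ (LinearMap.pi fun i => d i • LinearMap.proj i) ∘ₗ A) {a b c : ℝ} (ha : 0 ≤ a)
    (hb : 0 ≤ b) (hc : 0 ≤ c) (hA : ∀ x, ‖x‖ ≤ 1 → supNormFin (A x) ≤ a)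
    (hd : ∀ x : Fin k → ℝ, supNormFin x ≤ 1 → lqNormFin q (fun i => d i * x i) ≤ b)
    (hB : ∀ x, lqNormFin q x ≤ 1 → ‖B x‖ ≤ c) : nuQ q k v ≤ a * b * c := by
  refine (csInf_le (nuQ_bddBelow q k v) ⟨A, d, B, hv, rfl⟩).trans ?_
  refine mul_le_mul (mul_le_mul ?_ ?_ ?_ ha) ?_ ?_ (mul_nonneg ha hb)
  · exact Real.sSup_le (by rintro _ ⟨x, hx, rfl⟩; exact hA x hx) ha
  · exact Real.sSup_le (by rintro _ ⟨x, hx, rfl⟩; exact hd x hx) hb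
  · exact Real.sSup_nonneg (by rintro _ ⟨x, -, rfl⟩; exact lqNormFin_nonneg _ _)
  · exact Real.sSup_le (by rintro _ ⟨x, hx, rfl⟩; exact hB x hx) hc
  · exact Real.sSup_nonneg (by rintro _ ⟨x, -, rfl⟩; exact norm_nonneg _)

theorem lqNormFin_le_of_abs_le {q : ℝ} (hq : 0 < q) {k : ℕ} {x y : Fin k → ℝ}
    (h : ∀ i, |x i| ≤ |y i|) : lqNormFin q x ≤ lqNormFin q y := by
  unfold lqNormFin
  have : 0 ≤ ∑ i, |x i| ^ q :=
    Finset.sum_nonneg fun _ _ => Real.rpow_nonneg (abs_nonneg _) _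
  exact Real.rpow_le_rpow this (Finset.sum_le_sum fun i _ =>
    Real.rpow_le_rpow (abs_nonneg _) (h i) hq.le) (by positivity)

/-- The three norms in a factorization dominate the corresponding pointwise quantities. -/
theorem factor_norm_bounds [FiniteDimensional ℝ X] {p q : ℝ} (hpq : p.HolderConjugate q) {k : ℕ}
    (A : X →ₗ[ℝ] (Fin k → ℝ)) (d : Fin k → ℝ) (B : (Fin k → ℝ) →ₗ[ℝ] Y) :
    (∀ x, ‖x‖ ≤ 1 →
      supNormFin (A x) ≤ sSup {a | ∃ x : X, ‖x‖ ≤ 1 ∧ a = supNormFin (A x)}) ∧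
    lqNormFin q d ≤
      sSup {a | ∃ x : Fin k → ℝ, supNormFin x ≤ 1 ∧ a = lqNormFin q fun i => d i * x i} ∧
    ∀ φ : StrongDual ℝ Y, ‖φ‖ ≤ 1 → (∑ i, |φ (B (Pi.single i 1))| ^ p) ^ (1 / p) ≤
      sSup {a | ∃ x : Fin k → ℝ, lqNormFin q x ≤ 1 ∧ a = ‖B x‖} := by
  have hq : 0 < q := hpq.symm.pos
  refine ⟨fun x hx => le_csSup ⟨‖LinearMap.toContinuousLinearMap A‖, ?_⟩ ⟨x, hx, rfl⟩,
    le_csSup ⟨lqNormFin q d, ?_⟩ ⟨1, ?_, by simp⟩, fun φ hφ => ?_⟩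
  · rintro _ ⟨x, hx, rfl⟩
    refine supNormFin_le (norm_nonneg _) fun i => ?_
    have h1 := (LinearMap.toContinuousLinearMap A).unit_le_opNorm x hx
    exact (norm_le_pi_norm (A x) i).trans h1
  · rintro _ ⟨x, hx, rfl⟩
    refine lqNormFin_le_of_abs_le hq fun i => ?_
    rw [abs_mul]
    exact mul_le_of_le_one_right (abs_nonneg _) ((abs_apply_le_supNormFin x i).trans hx)
  · exact supNormFin_le zero_le_one fun i => by simp
  · have hbdd : BddAbove {a | ∃ x : Fin k → ℝ, lqNormFin q x ≤ 1 ∧ a = ‖B x‖} := by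
      refine ⟨‖LinearMap.toContinuousLinearMap B‖, ?_⟩
      rintro _ ⟨x, hx, rfl⟩
      refine (LinearMap.toContinuousLinearMap B).unit_le_opNorm x ?_
      exact (pi_norm_le_iff_of_nonneg zero_le_one).2 fun i =>
        abs_apply_le_one_of_lqNormFin_le_one hq hx i
    set c : Fin k → ℝ := fun i => φ (B (Pi.single i 1)) with hc
    obtain ⟨g, hg, hgeq⟩ := (NNReal.isGreatest_Lp Finset.univ (fun i => ‖c i‖₊) hpq).1
    have hgeq' := congrArg ((↑) : NNReal → ℝ) hgeq
    push_cast at hgeq'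
    simp only [Real.norm_eq_abs] at hgeq'
    have hg' : ∑ i, (g i : ℝ) ^ q ≤ 1 := by exact_mod_cast hg
    let x : Fin k → ℝ := fun i => SignType.sign (c i) * g i
    have hx : lqNormFin q x ≤ 1 := by
      rw [lqNormFin_le_one_iff hq]
      refine (Finset.sum_le_sum fun i _ => ?_).trans hg'
      have h1 : |(SignType.sign (c i) : ℝ)| ≤ 1 := by
        rcases lt_trichotomy (c i) 0 with h | h | h <;> simp [h]
      have h2 : |x i| ≤ g i := by
        simp only [x]
        rw [abs_mul, NNReal.abs_eq]
        exact mul_le_of_le_one_left (g i).2 h1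
      gcongr
    have hBx : φ (B x) = ∑ i, |c i| * g i := by
      have e1 : x = ∑ i, x i • (Pi.single i 1 : Fin k → ℝ) := by
        funext j
        simp [Finset.sum_apply, Pi.single_apply]
      rw [e1, map_sum, map_sum]
      refine Finset.sum_congr rfl fun i _ => ?_
      rw [map_smul, map_smul, smul_eq_mul]
      change SignType.sign (c i) * (g i : ℝ) * c i = _
      rw [mul_right_comm, sign_mul_self]
    rw [← hgeq', ← hBx]
    refine le_trans ?_ (le_csSup hbdd ⟨x, hx, rfl⟩)
    exact (le_abs_self _).trans ((φ.le_opNorm _).trans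
      (mul_le_of_le_one_left (norm_nonneg _) hφ))

end Factorization

section Splitting

variable {X Y : Type*} [NormedAddCommGroup X] [NormedSpace ℝ X] [NormedAddCommGroup Y]
  [NormedSpace ℝ Y]

theorem sum_comp_orderEmbOfFin {M : Type*} [AddCommMonoid M] {N k : ℕ} {S : Finset (Fin N)}
    (hS : S.card = k) {g : Fin N → M} (hg : ∀ i ∉ S, g i = 0) :
    ∑ j, g (S.orderEmbOfFin hS j) = ∑ i, g i := by
  rw [← Finset.sum_subset (Finset.subset_univ S) fun i _ hi => hg i hi]
  refine Finset.sum_bij (fun j _ => S.orderEmbOfFin hS j) (fun j _ => S.orderEmbOfFin_mem hS j)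
    (fun i _ j _ h => (S.orderEmbOfFin hS).injective h) (fun i hi => ?_) fun _ _ => rfl
  have : i ∈ Set.range (S.orderEmbOfFin hS) := by
    rw [Finset.range_orderEmbOfFin]; exact hi
  obtain ⟨j, hj⟩ := this
  exact ⟨j, Finset.mem_univ j, hj⟩

theorem comp_diagonal_comp_apply {k : ℕ} (A : X →ₗ[ℝ] (Fin k → ℝ)) (d : Fin k → ℝ)
    (B : (Fin k → ℝ) →ₗ[ℝ] Y) (x : X) :
    (B ∘ₗ (LinearMap.pi fun i => d i • LinearMap.proj i) ∘ₗ A) x =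
      ∑ i, (d i * A x i) • B (Pi.single i 1) := by
  have e1 : (LinearMap.pi fun i => d i • LinearMap.proj i : (Fin k → ℝ) →ₗ[ℝ] Fin k → ℝ) (A x) =
      ∑ i, (d i * A x i) • (Pi.single i 1 : Fin k → ℝ) := by
    funext j
    simp [Finset.sum_apply, Pi.single_apply]
  rw [LinearMap.comp_apply, LinearMap.comp_apply, e1, map_sum]
  simp only [map_smul]

/-- Reweighting the diagonal of a factorization by `v` costs a factor `θ` if `v` is supported on
`k` coordinates and contracts the two relevant norms. -/
theorem nuQ_reweight_le [FiniteDimensional ℝ X] {p q : ℝ} (hpq : p.HolderConjugate q) {N k : ℕ}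
    (hkN : k ≤ N) (A : X →ₗ[ℝ] (Fin N → ℝ)) (d : Fin N → ℝ) (B : (Fin N → ℝ) →ₗ[ℝ] Y)
    {v : Fin N → ℝ} (hv : ∀ i, 0 ≤ v i) (hcard : (Finset.univ.filter fun i => v i ≠ 0).card ≤ k)
    {θ : ℝ} (hθ : 0 ≤ θ) (hd : ∑ i, v i * |d i| ^ q ≤ θ * ∑ i, |d i| ^ q)
    (hB : ∀ φ : StrongDual ℝ Y, ∑ i, v i * |φ (B (Pi.single i 1))| ^ p ≤
      θ * ∑ i, |φ (B (Pi.single i 1))| ^ p) :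
    nuQ q k (B ∘ₗ (LinearMap.pi fun i => (v i * d i) • LinearMap.proj i) ∘ₗ A) ≤
      θ * (sSup {a | ∃ x : X, ‖x‖ ≤ 1 ∧ a = supNormFin (A x)} *
        sSup {a | ∃ x : Fin N → ℝ, supNormFin x ≤ 1 ∧ a = lqNormFin q fun i => d i * x i} *
        sSup {a | ∃ x : Fin N → ℝ, lqNormFin q x ≤ 1 ∧ a = ‖B x‖}) := by
  classical
  obtain ⟨hsA, hsd, hsB⟩ := factor_norm_bounds hpq A d B
  have hsA0 : 0 ≤ sSup {a | ∃ x : X, ‖x‖ ≤ 1 ∧ a = supNormFin (A x)} :=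
    Real.sSup_nonneg (by rintro _ ⟨x, -, rfl⟩; exact supNormFin_nonneg _)
  have hsd0 : 0 ≤ sSup {a | ∃ x : Fin N → ℝ, supNormFin x ≤ 1 ∧
      a = lqNormFin q fun i => d i * x i} :=
    Real.sSup_nonneg (by rintro _ ⟨x, -, rfl⟩; exact lqNormFin_nonneg _ _)
  have hsB0 : 0 ≤ sSup {a | ∃ x : Fin N → ℝ, lqNormFin q x ≤ 1 ∧ a = ‖B x‖} :=
    Real.sSup_nonneg (by rintro _ ⟨x, -, rfl⟩; exact norm_nonneg _)
  set sA := sSup {a | ∃ x : X, ‖x‖ ≤ 1 ∧ a = supNormFin (A x)}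
  set sd := sSup {a | ∃ x : Fin N → ℝ, supNormFin x ≤ 1 ∧ a = lqNormFin q fun i => d i * x i}
  set sB := sSup {a | ∃ x : Fin N → ℝ, lqNormFin q x ≤ 1 ∧ a = ‖B x‖}
  have hp : 0 < p := hpq.pos
  have hq : 0 < q := hpq.symm.pos
  obtain ⟨S, hS, hSk⟩ := Finset.exists_superset_card_eq hcard (by simpa using hkN)
  have hS0 : ∀ i ∉ S, v i = 0 := fun i hi => by
    by_contra h
    exact hi (hS (Finset.mem_filter.2 ⟨Finset.mem_univ i, h⟩))
  let σ : Fin k → Fin N := S.orderEmbOfFin hSk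
  let A' : X →ₗ[ℝ] (Fin k → ℝ) := LinearMap.pi fun j => LinearMap.proj (σ j) ∘ₗ A
  let d' : Fin k → ℝ := fun j => v (σ j) ^ (1 / q) * d (σ j)
  let B' : (Fin k → ℝ) →ₗ[ℝ] Y := Fintype.linearCombination ℝ
    fun j => v (σ j) ^ (1 / p) • B (Pi.single (σ j) 1)
  have hB'apply : ∀ z, B' z = ∑ j, z j • v (σ j) ^ (1 / p) • B (Pi.single (σ j) 1) := fun z =>
    Fintype.linearCombination_apply ℝ _ z
  have hvp : ∀ i (t : ℝ), 0 ≤ t → (v i ^ (1 / p) * t) ^ p = v i * t ^ p := fun i t ht => by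
    rw [Real.mul_rpow (Real.rpow_nonneg (hv i) _) ht, one_div, Real.rpow_inv_rpow (hv i) hp.ne']
  have hvq : ∀ i (t : ℝ), 0 ≤ t → (v i ^ (1 / q) * t) ^ q = v i * t ^ q := fun i t ht => by
    rw [Real.mul_rpow (Real.rpow_nonneg (hv i) _) ht, one_div, Real.rpow_inv_rpow (hv i) hq.ne']
  have hvpq : ∀ i, v i ^ (1 / q) * v i ^ (1 / p) = v i := fun i => by
    rcases (hv i).eq_or_lt with h | h
    · rw [← h, Real.zero_rpow (one_div_pos.2 hp).ne', mul_zero]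
    · rw [← Real.rpow_add h, one_div, one_div, add_comm, hpq.inv_add_inv_eq_one, Real.rpow_one]
  have hfac : B ∘ₗ (LinearMap.pi fun i => (v i * d i) • LinearMap.proj i) ∘ₗ A =
      B' ∘ₗ (LinearMap.pi fun j => d' j • LinearMap.proj j) ∘ₗ A' := by
    ext x
    rw [comp_diagonal_comp_apply, comp_diagonal_comp_apply,
      ← sum_comp_orderEmbOfFin hSk (g := fun i => (v i * d i * A x i) • B (Pi.single i 1))
        fun i hi => by rw [hS0 i hi, zero_mul, zero_mul, zero_smul]]
    refine Finset.sum_congr rfl fun j _ => ?_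
    have e1 : B' (Pi.single j 1) = v (σ j) ^ (1 / p) • B (Pi.single (σ j) 1) := by
      rw [hB'apply, Finset.sum_eq_single j (fun i _ hi => by simp [hi]) (by simp)]
      simp
    have e2 : A' x j = A x (σ j) := rfl
    rw [e1, e2, smul_smul]
    congr 1
    simp only [d']
    conv_lhs => rw [← hvpq (σ j)]
    ring
  have hθpq : θ ^ (1 / q) * θ ^ (1 / p) = θ := by
    rcases hθ.eq_or_lt with h | h
    · rw [← h, Real.zero_rpow (one_div_pos.2 hp).ne', mul_zero]
    · rw [← Real.rpow_add h, one_div, one_div, add_comm, hpq.inv_add_inv_eq_one, Real.rpow_one]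
  have hmain := nuQ_le A' d' B' hfac (a := sA) (b := θ ^ (1 / q) * sd) (c := θ ^ (1 / p) * sB)
    hsA0 (by positivity) (by positivity)
    (fun x hx => supNormFin_le hsA0 fun j => (abs_apply_le_supNormFin (A x) (σ j)).trans (hsA x hx))
    (fun x hx => by
      have h1 : lqNormFin q (fun j => d' j * x j) ≤ lqNormFin q d' :=
        lqNormFin_le_of_abs_le hq fun j => by
          rw [abs_mul]
          exact mul_le_of_le_one_right (abs_nonneg _) ((abs_apply_le_supNormFin x j).trans hx)
      refine h1.trans (le_trans ?_ (mul_le_mul_of_nonneg_left hsd (by positivity)))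
      have e1 : ∑ j, |d' j| ^ q = ∑ i, v i * |d i| ^ q := by
        rw [← sum_comp_orderEmbOfFin hSk (g := fun i => v i * |d i| ^ q)
          fun i hi => by rw [hS0 i hi, zero_mul]]
        refine Finset.sum_congr rfl fun j _ => ?_
        simp only [d']
        rw [abs_mul, abs_of_nonneg (Real.rpow_nonneg (hv _) _), hvq _ _ (abs_nonneg _)]
      have h0 : 0 ≤ ∑ i, |d i| ^ q := Finset.sum_nonneg fun i _ => by positivity
      rw [lqNormFin, lqNormFin, e1, ← Real.mul_rpow hθ h0]
      exact Real.rpow_le_rpow (Finset.sum_nonneg fun i _ => mul_nonneg (hv i) (by positivity)) hd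
        (by positivity))
    (fun z hz => by
      obtain ⟨φ, hφ, hφz⟩ := exists_dual_vector'' ℝ (B' z)
      have hφz' : φ (B' z) = ‖B' z‖ := by simpa using hφz
      set c : Fin N → ℝ := fun i => φ (B (Pi.single i 1)) with hc
      have e1 : φ (B' z) = ∑ j, (v (σ j) ^ (1 / p) * c (σ j)) * z j := by
        rw [hB'apply, map_sum]
        refine Finset.sum_congr rfl fun j _ => ?_
        rw [map_smul, map_smul, smul_eq_mul, smul_eq_mul, mul_comm]
      rw [← hφz', e1]
      refine (Real.inner_le_Lp_mul_Lq Finset.univ _ z hpq).trans ?_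
      have e2 : ∑ j, |v (σ j) ^ (1 / p) * c (σ j)| ^ p = ∑ i, v i * |c i| ^ p := by
        rw [← sum_comp_orderEmbOfFin hSk (g := fun i => v i * |c i| ^ p)
          fun i hi => by rw [hS0 i hi, zero_mul]]
        refine Finset.sum_congr rfl fun j _ => ?_
        rw [abs_mul, abs_of_nonneg (Real.rpow_nonneg (hv _) _), hvp _ _ (abs_nonneg _)]
      have h0 : 0 ≤ ∑ i, |c i| ^ p := Finset.sum_nonneg fun i _ => by positivity
      have h1 : 0 ≤ ∑ i, v i * |c i| ^ p :=
        Finset.sum_nonneg fun i _ => mul_nonneg (hv i) (by positivity)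
      rw [e2]
      refine (mul_le_of_le_one_right (by positivity) hz).trans ?_
      refine (Real.rpow_le_rpow h1 (hB φ) (by positivity)).trans ?_
      rw [Real.mul_rpow hθ h0]
      exact mul_le_mul_of_nonneg_left (hsB φ hφ) (by positivity))
  refine hmain.trans (le_of_eq ?_)
  calc _ = (θ ^ (1 / q) * θ ^ (1 / p)) * (sA * sd * sB) := by ring
    _ = _ := by rw [hθpq]

theorem nuQSplit_le_add {q : ℝ} {k : ℕ} (u₁ u₂ : X →ₗ[ℝ] Y) :
    nuQSplit q k 2 (u₁ + u₂) ≤ nuQ q k u₁ + nuQ q k u₂ := by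
  refine csInf_le ⟨0, ?_⟩ ⟨![u₁, u₂], by simp, by simp⟩
  rintro _ ⟨u, -, rfl⟩
  exact Finset.sum_nonneg fun i _ => nuQ_nonneg q k (u i)

theorem nuQSplit_one (q : ℝ) (k : ℕ) (u : X →ₗ[ℝ] Y) : nuQSplit q k 1 u = nuQ q k u := by
  have : {r : ℝ | ∃ v : Fin 1 → (X →ₗ[ℝ] Y), u = ∑ i, v i ∧ r = ∑ i, nuQ q k (v i)} =
      {nuQ q k u} := by
    ext r
    constructor
    · rintro ⟨v, hv, rfl⟩
      simp only [Fin.sum_univ_one] at hv ⊢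
      rw [hv]; rfl
    · rintro rfl
      exact ⟨fun _ => u, by simp, by simp⟩
  rw [nuQSplit, this, csInf_singleton]

theorem exists_factorization [FiniteDimensional ℝ Y] {k : ℕ} (hk : Module.finrank ℝ Y ≤ k)
    (u : X →ₗ[ℝ] Y) : ∃ (A : X →ₗ[ℝ] (Fin k → ℝ)) (d : Fin k → ℝ) (B : (Fin k → ℝ) →ₗ[ℝ] Y),
      u = B ∘ₗ (LinearMap.pi fun i => d i • LinearMap.proj i) ∘ₗ A := by
  obtain ⟨f, hf⟩ := (finrank_le_iff_exists_linearMap (R := ℝ) (M := Y) (M' := Fin k → ℝ)).1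
    (by simpa using hk)
  obtain ⟨g, hg⟩ := f.exists_leftInverse_of_injective (LinearMap.ker_eq_bot.2 hf)
  refine ⟨f ∘ₗ u, 1, g, ?_⟩
  have e1 : (LinearMap.pi fun i => (1 : Fin k → ℝ) i • LinearMap.proj i :
      (Fin k → ℝ) →ₗ[ℝ] Fin k → ℝ) = LinearMap.id := by
    ext; simp
  rw [e1, LinearMap.id_comp, ← LinearMap.comp_assoc, hg, LinearMap.id_comp]

/-- Splitting an operator into two pieces that factor through fewer coordinates. -/
theorem nuQSplit_two_le [FiniteDimensional ℝ X] [FiniteDimensional ℝ Y] {p q : ℝ}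
    (hpq : p.HolderConjugate q) (hp2 : p ≤ 2) {n N : ℕ} (hn : 2 ≤ n) (hnN : n ≤ N)
    (hY : Module.finrank ℝ Y ≤ n) {δ : ℝ}
    (hδ : 400000 * (√(n / N) * (Real.log n * √(Real.log n))) ≤ δ) (u : X →ₗ[ℝ] Y) :
    nuQSplit q ⌈(7 * (N : ℝ)) / 8⌉₊ 2 u ≤ (1 + δ) * nuQSplit q N 1 u := by
  have hδ0 : 0 ≤ δ := le_trans (by
    have := one_half_le_log_mul_sqrt_log (n := n) (by exact_mod_cast hn)
    positivity) hδ
  have hkN : ⌈(7 * (N : ℝ)) / 8⌉₊ ≤ N := Nat.ceil_le.2 (by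
    have : (0 : ℝ) ≤ N := Nat.cast_nonneg N
    linarith)
  rw [nuQSplit_one, ← div_le_iff₀' (by linarith)]
  obtain ⟨A₀, d₀, B₀, h₀⟩ := exists_factorization (hY.trans hnN) u
  refine le_csInf ⟨_, A₀, d₀, B₀, h₀, rfl⟩ ?_
  rintro _ ⟨A, d, B, rfl, rfl⟩
  rw [div_le_iff₀' (by linarith)]
  let T : Module.Dual ℝ Y →ₗ[ℝ] (Fin N → ℝ) :=
    LinearMap.pi fun i => Module.Dual.eval ℝ Y (B (Pi.single i 1))
  have hT : Module.finrank ℝ (LinearMap.range T) ≤ n :=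
    (LinearMap.finrank_range_le T).trans (by rwa [Subspace.dual_finrank_eq])
  obtain ⟨v, hv, hc₁, hc₂, ⟨hw₁, hw₂⟩, hE⟩ := exists_halving_weight hn hnN hpq.lt.le hp2
    (LinearMap.range T) hT (w := fun i => |d i| ^ q) (fun i => by positivity) hδ
  have hφ : ∀ φ : StrongDual ℝ Y, (fun i => φ (B (Pi.single i 1))) ∈ LinearMap.range T :=
    fun φ => ⟨φ.toLinearMap, rfl⟩
  have hnat : ∀ m : ℕ, (m : ℝ) ≤ 7 * N / 8 → m ≤ ⌈(7 * (N : ℝ)) / 8⌉₊ := fun m hm => by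
    exact_mod_cast hm.trans (Nat.le_ceil _)
  have h₁ := nuQ_reweight_le hpq hkN A d B (fun i => (hv i).1) (hnat _ hc₁) (θ := (1 + δ) / 2)
    (by linarith) hw₁ fun φ => (hE _ (hφ φ)).1
  have h₂ := nuQ_reweight_le hpq hkN A d B (v := fun i => 1 - v i)
    (fun i => by linarith [(hv i).2]) (hnat _ hc₂) (θ := (1 + δ) / 2)
    (by linarith) hw₂ fun φ => (hE _ (hφ φ)).2
  have hsplit : B ∘ₗ (LinearMap.pi fun i => d i • LinearMap.proj i) ∘ₗ A =
      B ∘ₗ (LinearMap.pi fun i => (v i * d i) • LinearMap.proj i) ∘ₗ A +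
      B ∘ₗ (LinearMap.pi fun i => ((1 - v i) * d i) • LinearMap.proj i) ∘ₗ A := by
    ext x
    rw [LinearMap.add_apply, comp_diagonal_comp_apply, comp_diagonal_comp_apply,
      comp_diagonal_comp_apply, ← Finset.sum_add_distrib]
    refine Finset.sum_congr rfl fun i _ => ?_
    rw [← add_smul]
    congr 1
    ring
  rw [hsplit]
  refine (nuQSplit_le_add _ _).trans ((add_le_add h₁ h₂).trans (le_of_eq ?_))
  ring

end Splitting

/-- Proposition 3.1 (i): for `1 < p < 2`, `q = p/(p-1)`, `2 ≤ n ≤ N` and an operator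
`u : X → Y` with `X` finite dimensional and `dim Y ≤ n`,
`ν_q^{(⌈7N/8⌉,2)}(u) ≤ (1 + C (p-1)^{(p-2)/4} (n/N)^{1/2} (log n)^{(6-p)/4} (log N)^{p/4})
· ν_q^{(N,1)}(u)` for an absolute constant `C`. -/
theorem nuQ_split_bound_one_lt_p_lt_two :
    ∃ C : ℝ, 0 < C ∧
      ∀ (p : ℝ), 1 < p → p < 2 →
      ∀ (n N : ℕ), 2 ≤ n → n ≤ N →
      ∀ (X Y : Type) [NormedAddCommGroup X] [NormedSpace ℝ X]
        [NormedAddCommGroup Y] [NormedSpace ℝ Y],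
      FiniteDimensional ℝ X → FiniteDimensional ℝ Y → Module.finrank ℝ Y ≤ n →
      ∀ (u : X →ₗ[ℝ] Y),
        nuQSplit (p / (p - 1)) ⌈(7 * (N : ℝ)) / 8⌉₊ 2 u ≤
          (1 + C * (p - 1) ^ ((p - 2) / 4) * Real.sqrt ((n : ℝ) / N) *
              Real.log n ^ ((6 - p) / 4) * Real.log N ^ (p / 4)) *
            nuQSplit (p / (p - 1)) N 1 u := by
  refine ⟨400000, by norm_num, fun p hp hp2 n N hn hnN X Y _ _ _ _ _ _ hY u => ?_⟩
  refine nuQSplit_two_le (Real.HolderConjugate.conjExponent hp) hp2.le hn hnN hY ?_ u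
  have hn' : (2 : ℝ) ≤ n := by exact_mod_cast hn
  have hnN' : (n : ℝ) ≤ N := by exact_mod_cast hnN
  have hlog : 0 < Real.log n := Real.log_pos (by linarith)
  have hlogN : Real.log n ≤ Real.log N := Real.log_le_log (by linarith) hnN'
  have h1 : 1 ≤ (p - 1) ^ ((p - 2) / 4) :=
    Real.one_le_rpow_of_pos_of_le_one_of_nonpos (by linarith) (by linarith) (by linarith)
  have h2 : Real.log n * √(Real.log n) ≤
      Real.log n ^ ((6 - p) / 4) * Real.log N ^ (p / 4) := by
    calc Real.log n * √(Real.log n) = Real.log n ^ ((6 - p) / 4) * Real.log n ^ (p / 4) := by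
          rw [Real.sqrt_eq_rpow, ← Real.rpow_one_add' hlog.le (by norm_num), ← Real.rpow_add hlog]
          congr 1; ring
      _ ≤ _ := by gcongr
  calc _ ≤ 400000 * (√((n : ℝ) / N) *
        (Real.log n ^ ((6 - p) / 4) * Real.log N ^ (p / 4))) := by gcongr
    _ = 400000 * 1 * √((n : ℝ) / N) * Real.log n ^ ((6 - p) / 4) * Real.log N ^ (p / 4) := by ring
    _ ≤ _ := by
      have : 0 ≤ Real.log N := hlog.le.trans hlogN
      gcongr
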